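/- arXiv:1810.12263 — 7 statements merged into one kernel-verified Lean document; each statement's English description precedes it below -/
import Mathlib

section
/- (PAC-Bayesian theorem.) Let H be a measurable hypothesis space, X×Y a measurable example space, ℓ : Y×Y → [0,1] a measurable loss function, μ a probability measure on X×Y, N a positive natural number, P a probability measure on H, and δ ∈ (0,1]. For a hypothesis h define the true risk R(h) = ∫ ℓ(y, h(x)) dμ(x,y), and for a training sample S = ((x₁,y₁),…,(x_N,y_N)) define the empirical risk R_S(h) = (1/N) Σ_{i=1}^N ℓ(y_i, h(x_i)); for a probability measure Q on H set R(Q) = E_{h∼Q}[R(h)] and R_S(Q) = E_{h∼Q}[R_S(h)]. Then, with probability at least 1−δ over S drawn i.i.d. from μ^N, simultaneously for all probability measures Q on H: kl(R_S(Q) ‖ R(Q)) ≤ (KL(Q‖P) + ln(2√N/δ)) / N, where kl(q‖p) = q ln(q/p) + (1−q) ln((1−q)/(1−p)) is the binary KL divergence and KL(Q‖P) is the Kullback–Leibler divergence of Q from P. Equivalently, R(Q) ≤ kl⁻¹(R_S(Q), (KL(Q‖P) + ln(2√N/δ))/N), where kl⁻¹(q,ε) := max{p ∈ [0,1] : kl(q‖p)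 ≤ ε}. -/
open MeasureTheory ENNReal NNReal
open scoped Classical

/-- Kullback–Leibler divergence: `KL(Q‖P) = ∫ ln(dQ/dP) dQ` if `Q ≪ P` (and the
integral is well defined, i.e. `+∞` if it diverges), and `+∞` otherwise. -/
noncomputable def klDiv {α : Type*} [MeasurableSpace α] (Q P : Measure α) : ℝ≥0∞ :=
  if Q ≪ P ∧ Integrable (llr Q P) Q then ENNReal.ofReal (∫ x, llr Q P x ∂Q) else ⊤

/-- Binary KL divergence `kl(q‖p)`, with the conventions `0 · ln 0 = 0` and
`kl(q‖p) = +∞` when `p ∈ {0,1}` and `q ≠ p`. -/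
noncomputable def bkl (q p : ℝ) : ℝ≥0∞ :=
  if q = p then 0
  else if p = 0 ∨ p = 1 then ⊤
  else ENNReal.ofReal (q * Real.log (q / p) + (1 - q) * Real.log ((1 - q) / (1 - p)))

lemma sum_inv_sqrt_le (n : ℕ) : ∑ k ∈ Finset.Icc 1 n, 1 / √(k : ℝ) ≤ 2 * √n := by
  induction n with
  | zero => simp
  | succ n ih =>
    rw [Finset.sum_Icc_succ_top (by omega)]
    have h1 : 0 < √((n + 1 : ℕ) : ℝ) := by positivity
    have h0 : 0 ≤ √(n : ℝ) := by positivity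
    have e1 : √((n + 1 : ℕ) : ℝ) ^ 2 = n + 1 := by rw [Real.sq_sqrt (by positivity)]; simp
    have e0 : √(n : ℝ) ^ 2 = n := Real.sq_sqrt (by positivity)
    have : 1 / √((n + 1 : ℕ) : ℝ) ≤ 2 * √((n + 1 : ℕ) : ℝ) - 2 * √n := by
      rw [div_le_iff₀ h1]
      nlinarith [sq_nonneg (√((n + 1 : ℕ) : ℝ) - √(n : ℝ))]
    linarith

lemma sum_choose_mul_pow_sq_le {N : ℕ} (h0 : 0 < N) (hN : N < 25) :
    (∑ k ∈ Finset.range (N + 1), N.choose k * (k ^ k * (N - k) ^ (N - k))) ^ 2 ≤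
      4 * N * (N ^ N) ^ 2 := by
  simp only [Nat.choose_eq_descFactorial_div_factorial]
  interval_cases N <;> simp only [Finset.sum_range_succ, Finset.sum_range_zero] <;>
    norm_num [Nat.descFactorial, Nat.factorial]

lemma factorial_eq_stirlingSeq_mul {n : ℕ} (hn : n ≠ 0) :
    (n.factorial : ℝ) = Stirling.stirlingSeq n * (√(2 * n) * (n / Real.exp 1) ^ n) := by
  rw [Stirling.stirlingSeq, div_mul_cancel₀]
  positivity

lemma binomial_mode_le {k m : ℕ} (hk : k ≠ 0) (hm : m ≠ 0) :
    ((k + m).choose k : ℝ) * ((k / (k + m : ℕ)) ^ k * (m / (k + m : ℕ)) ^ m) ≤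
      2 / 5 * (1 / √(k : ℝ) + 1 / √(m : ℝ)) := by
  have hk0 : (0 : ℝ) < k := by positivity
  have hm0 : (0 : ℝ) < m := by positivity
  have hs : Stirling.stirlingSeq (k + m) ≤ Stirling.stirlingSeq k := by
    obtain ⟨k, rfl⟩ := Nat.exists_eq_succ_of_ne_zero hk
    have := Stirling.stirlingSeq'_antitone (show k ≤ k + m by omega)
    simpa [Nat.succ_eq_add_one, add_right_comm] using this
  have hk1 := Stirling.sqrt_pi_le_stirlingSeq hk
  have hm1 := Stirling.sqrt_pi_le_stirlingSeq hm
  have hpi : 0 < √Real.pi := by positivity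
  have hpi2 : 5 / 4 * √2 ≤ √Real.pi := by
    rw [← Real.sqrt_sq (by norm_num : (0 : ℝ) ≤ 5 / 4), ← Real.sqrt_mul (by norm_num)]
    exact Real.sqrt_le_sqrt (by linarith [Real.pi_gt_d2])
  have hk2 : 0 < Stirling.stirlingSeq k := hpi.trans_le hk1
  have hm2 : 0 < Stirling.stirlingSeq m := hpi.trans_le hm1
  have key : ((k + m).choose k : ℝ) * ((k / (k + m : ℕ)) ^ k * (m / (k + m : ℕ)) ^ m) =
      Stirling.stirlingSeq (k + m) / (Stirling.stirlingSeq k * Stirling.stirlingSeq m) *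
        (√(k + m) / (√2 * (√k * √m))) := by
    rw [Nat.cast_add_choose, factorial_eq_stirlingSeq_mul hk, factorial_eq_stirlingSeq_mul hm,
      factorial_eq_stirlingSeq_mul (by omega)]
    push_cast
    rw [Real.sqrt_mul (by norm_num), Real.sqrt_mul (by norm_num), Real.sqrt_mul (by norm_num)]
    simp only [div_pow, pow_add]
    field_simp
  have hsq : √((k : ℝ) + m) ≤ √k + √m := by
    rw [Real.sqrt_le_left (by positivity)]
    nlinarith [Real.sq_sqrt hk0.le, Real.sq_sqrt hm0.le, Real.sqrt_nonneg (k : ℝ),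
      Real.sqrt_nonneg (m : ℝ), mul_nonneg (Real.sqrt_nonneg (k : ℝ)) (Real.sqrt_nonneg (m : ℝ))]
  have h1 : Stirling.stirlingSeq (k + m) / (Stirling.stirlingSeq k * Stirling.stirlingSeq m) ≤
      1 / (5 / 4 * √2) := by
    rw [div_le_div_iff₀ (by positivity) (by positivity)]
    have : 5 / 4 * √2 ≤ Stirling.stirlingSeq m := hpi2.trans hm1
    nlinarith [mul_le_mul hs this (by positivity) hk2.le]
  rw [key]
  calc _ ≤ 1 / (5 / 4 * √2) * ((√k + √m) / (√2 * (√k * √m))) := by gcongr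
    _ = 2 / 5 * (1 / √(k : ℝ) + 1 / √(m : ℝ)) := by
      have h2 : √(2 : ℝ) ^ 2 = 2 := Real.sq_sqrt (by norm_num)
      field_simp
      rw [h2]; ring

theorem sum_binomial_mode_le {N : ℕ} (hN : 0 < N) :
    ∑ k ∈ Finset.range (N + 1),
      (N.choose k : ℝ) * (((k : ℝ) / N) ^ k * (((N - k : ℕ) : ℝ) / N) ^ (N - k)) ≤ 2 * √N := by
  have hN0 : (0 : ℝ) < N := by positivity
  rcases lt_or_ge N 25 with h | h
  · have hsm := sum_choose_mul_pow_sq_le hN h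
    have hsm' : ((∑ k ∈ Finset.range (N + 1),
        (N.choose k : ℝ) * (k ^ k * ((N - k : ℕ) : ℝ) ^ (N - k)))) ^ 2 ≤
        4 * N * ((N : ℝ) ^ N) ^ 2 := by exact_mod_cast hsm
    have heq : ∑ k ∈ Finset.range (N + 1),
        (N.choose k : ℝ) * (((k : ℝ) / N) ^ k * (((N - k : ℕ) : ℝ) / N) ^ (N - k)) =
        (∑ k ∈ Finset.range (N + 1),
          (N.choose k : ℝ) * (k ^ k * ((N - k : ℕ) : ℝ) ^ (N - k))) / (N : ℝ) ^ N := by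
      rw [Finset.sum_div]
      refine Finset.sum_congr rfl fun k hk => ?_
      have : N = k + (N - k) := by have := Finset.mem_range.1 hk; omega
      have h2 : (N : ℝ) ^ N = (N : ℝ) ^ k * (N : ℝ) ^ (N - k) := by rw [← pow_add, ← this]
      rw [h2, div_pow, div_pow]
      field_simp
    rw [heq, div_le_iff₀ (by positivity)]
    refine abs_le_of_sq_le_sq' ?_ (by positivity) |>.2
    rw [mul_pow, mul_pow, Real.sq_sqrt hN0.le]
    linarith
  · obtain ⟨n, rfl⟩ : ∃ n, N = n + 1 := ⟨N - 1, by omega⟩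
    have hmid : ∀ k ∈ Finset.Icc 1 n, ((n + 1).choose k : ℝ) *
        (((k : ℝ) / (n + 1 : ℕ)) ^ k * (((n + 1 - k : ℕ) : ℝ) / (n + 1 : ℕ)) ^ (n + 1 - k)) ≤
        2 / 5 * (1 / √(k : ℝ) + 1 / √((n + 1 - k : ℕ) : ℝ)) := by
      intro k hk
      obtain ⟨hk1, hk2⟩ := Finset.mem_Icc.1 hk
      have := binomial_mode_le (k := k) (m := n + 1 - k) (by omega) (by omega)
      rwa [show k + (n + 1 - k) = n + 1 by omega] at this
    have hrefl : ∑ k ∈ Finset.Icc 1 n, 1 / √((n + 1 - k : ℕ) : ℝ) =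
        ∑ k ∈ Finset.Icc 1 n, 1 / √(k : ℝ) :=
      Finset.sum_bij' (fun k _ => n + 1 - k) (fun k _ => n + 1 - k)
        (by simp only [Finset.mem_Icc]; omega) (by simp only [Finset.mem_Icc]; omega)
        (by simp only [Finset.mem_Icc]; omega) (by simp only [Finset.mem_Icc]; omega)
        (fun _ _ => rfl)
    have hsplit : Finset.range (n + 1 + 1) = insert 0 (insert (n + 1) (Finset.Icc 1 n)) := by
      ext k; simp; omega
    have hS := Finset.sum_le_sum hmid
    rw [← Finset.mul_sum, Finset.sum_add_distrib, hrefl] at hS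
    rw [hsplit, Finset.sum_insert (by simp), Finset.sum_insert (by simp)]
    have hsq : 5 ≤ √((n + 1 : ℕ) : ℝ) := by
      apply Real.le_sqrt_of_sq_le
      have : ((25 : ℕ) : ℝ) ≤ (n + 1 : ℕ) := by exact_mod_cast h
      norm_num at this ⊢; linarith
    have hmono : √(n : ℝ) ≤ √((n + 1 : ℕ) : ℝ) := Real.sqrt_le_sqrt (by simp)
    have hz : ((n + 1 : ℕ) : ℝ) / (n + 1 : ℕ) = 1 := div_self hN0.ne'
    simp only [Nat.choose_zero_right, Nat.choose_self, Nat.sub_zero, Nat.sub_self, hz, pow_zero,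
      one_pow, mul_one, Nat.cast_one]
    linarith [sum_inv_sqrt_le n]

lemma ofReal_pow_mul_exp_le (k : ℕ) {N : ℕ} (hN : 0 < N) {p r : ℝ} (hp : 0 ≤ p) (hr : 0 < r) :
    ENNReal.ofReal (r ^ k * Real.exp (k - N * (p * r))) ≤
      ((k / N : ℝ≥0∞) / ENNReal.ofReal p) ^ k := by
  have hN0 : (0 : ℝ) < N := by positivity
  rcases Nat.eq_zero_or_pos k with rfl | hk
  · simp only [pow_zero, one_mul, Nat.cast_zero, zero_sub]
    refine ENNReal.ofReal_le_one.2 (Real.exp_le_one_iff.2 ?_)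
    have := mul_nonneg hN0.le (mul_nonneg hp hr.le)
    linarith
  have hk0 : (0 : ℝ) < k := by positivity
  rcases hp.eq_or_lt with rfl | hp
  · have : ((k : ℝ≥0∞) / N) / ENNReal.ofReal 0 = ⊤ := by
      rw [ENNReal.ofReal_zero]
      refine ENNReal.div_zero (ENNReal.div_pos ?_ (by simp)).ne'
      exact_mod_cast hk.ne'
    rw [this, ENNReal.top_pow hk.ne']
    exact le_top
  have h1 : ((k : ℝ≥0∞) / N) / ENNReal.ofReal p = ENNReal.ofReal (k / N / p) := by
    rw [ENNReal.ofReal_div_of_pos hp, ENNReal.ofReal_div_of_pos hN0, ENNReal.ofReal_natCast,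
      ENNReal.ofReal_natCast]
  rw [h1, ← ENNReal.ofReal_pow (by positivity)]
  refine ENNReal.ofReal_le_ofReal ?_
  have h2 : Real.exp (k - N * (p * r)) = Real.exp (1 - N * (p * r) / k) ^ k := by
    rw [← Real.exp_nat_mul]
    congr 1
    field_simp
  rw [h2, ← mul_pow]
  refine pow_le_pow_left₀ (by positivity) ?_ k
  have h3 := Real.add_one_le_exp (N * (p * r) / k - 1)
  rw [sub_add_cancel] at h3
  have h4 : Real.exp (1 - N * (p * r) / k) = (Real.exp (N * (p * r) / k - 1))⁻¹ := by
    rw [← Real.exp_neg, neg_sub]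
  rw [h4, ← div_eq_mul_inv, div_le_iff₀ (Real.exp_pos _)]
  calc r = k / N / p * (N * (p * r) / k) := by field_simp
    _ ≤ _ := by gcongr

/-- The value `exp (N * kl(k / N ‖ p))` of the exponentiated binary divergence at a sample
with `k` losses out of `N`, up to the entropy conventions at `p ∈ {0, 1}`. -/
noncomputable def expBinaryKL (N : ℕ) (p : ℝ) (k : ℕ) : ℝ≥0∞ :=
  ((k / N : ℝ≥0∞) / ENNReal.ofReal p) ^ k *
    (((N - k : ℕ) / N : ℝ≥0∞) / ENNReal.ofReal (1 - p)) ^ (N - k)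

/-- The expectation of `expBinaryKL N p` at the number of successes of independent Bernoulli
variables with parameters `x i`. -/
noncomputable def bernoulliExpKL (N : ℕ) (p : ℝ) (x : Fin N → ℝ) : ℝ≥0∞ :=
  ∑ t : Finset (Fin N), ((∏ i ∈ t, ENNReal.ofReal (x i)) *
    ∏ i ∈ tᶜ, ENNReal.ofReal (1 - x i)) * expBinaryKL N p t.card

lemma ofReal_exp_le_expBinaryKL {N k : ℕ} (hN : 0 < N) (hk : k ≤ N) {p r s : ℝ} (hp : 0 ≤ p)
    (hp1 : p ≤ 1) (hr : 0 < r) (hs : 0 < s) :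
    ENNReal.ofReal (r ^ k * s ^ (N - k) * Real.exp (N * (1 - p * r - (1 - p) * s))) ≤
      expBinaryKL N p k := by
  have h : r ^ k * s ^ (N - k) * Real.exp (N * (1 - p * r - (1 - p) * s)) =
      (r ^ k * Real.exp (k - N * (p * r))) *
        (s ^ (N - k) * Real.exp ((N - k : ℕ) - N * ((1 - p) * s))) := by
    rw [mul_mul_mul_comm, ← Real.exp_add, Nat.cast_sub hk]
    ring_nf
  rw [h, ENNReal.ofReal_mul (by positivity), expBinaryKL]
  exact mul_le_mul' (ofReal_pow_mul_exp_le k hN hp hr)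
    (ofReal_pow_mul_exp_le (N - k) hN (sub_nonneg.2 hp1) hs)

lemma ofReal_exp_le_bernoulliExpKL {N : ℕ} (hN : 0 < N) {p r s : ℝ} (hp : 0 ≤ p) (hp1 : p ≤ 1)
    (hr : 0 < r) (hs : 0 < s) {x : Fin N → ℝ} (hx : ∀ i, x i ∈ Set.Icc (0 : ℝ) 1) :
    ENNReal.ofReal (Real.exp (N * (((N : ℝ)⁻¹ * ∑ i, x i) * Real.log r +
      (1 - (N : ℝ)⁻¹ * ∑ i, x i) * Real.log s + (1 - p * r - (1 - p) * s)))) ≤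
      bernoulliExpKL N p x := by
  have hN0 : (N : ℝ) ≠ 0 := by positivity
  set c := 1 - p * r - (1 - p) * s with hc
  have h1 : Real.exp (N * (((N : ℝ)⁻¹ * ∑ i, x i) * Real.log r +
      (1 - (N : ℝ)⁻¹ * ∑ i, x i) * Real.log s + c)) =
      (∏ i, (r ^ x i * s ^ (1 - x i))) * Real.exp (N * c) := by
    simp_rw [Real.rpow_def_of_pos hr, Real.rpow_def_of_pos hs, ← Real.exp_add]
    rw [← Real.exp_sum, ← Real.exp_add, Finset.sum_add_distrib, ← Finset.mul_sum,
      ← Finset.mul_sum, Finset.sum_sub_distrib]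
    congr 1
    simp only [Finset.sum_const, Finset.card_univ, Fintype.card_fin, nsmul_eq_mul, mul_one]
    field_simp
  have h2 : ∏ i, (r ^ x i * s ^ (1 - x i)) ≤ ∏ i, (x i * r + (1 - x i) * s) :=
    Finset.prod_le_prod (fun i _ => by positivity) fun i _ =>
      Real.geom_mean_le_arith_mean2_weighted (hx i).1 (sub_nonneg.2 (hx i).2) hr.le hs.le
        (by ring)
  have h0 : ∀ i, 0 ≤ 1 - x i := fun i => sub_nonneg.2 (hx i).2
  have hx0 : ∀ i, 0 ≤ x i := fun i => (hx i).1
  rw [h1]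
  refine (ENNReal.ofReal_le_ofReal
    (mul_le_mul_of_nonneg_right h2 (Real.exp_pos _).le)).trans ?_
  rw [Fintype.prod_add, Finset.sum_mul, ENNReal.ofReal_sum_of_nonneg]
  · refine Finset.sum_le_sum fun t _ => ?_
    have ht : t.card ≤ N := by simpa using Finset.card_le_univ t
    have h3 : (∏ i ∈ t, x i * r) * (∏ i ∈ tᶜ, (1 - x i) * s) * Real.exp (N * c) =
        ((∏ i ∈ t, x i) * ∏ i ∈ tᶜ, (1 - x i)) *
          (r ^ t.card * s ^ (N - t.card) * Real.exp (N * c)) := by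
      rw [Finset.prod_mul_distrib, Finset.prod_mul_distrib, Finset.prod_const, Finset.prod_const,
        Finset.card_compl, Fintype.card_fin]
      ring
    rw [h3, ENNReal.ofReal_mul (mul_nonneg (Finset.prod_nonneg fun i _ => hx0 i)
      (Finset.prod_nonneg fun i _ => h0 i)),
      ENNReal.ofReal_mul (Finset.prod_nonneg fun i _ => hx0 i),
      ENNReal.ofReal_prod_of_nonneg fun i _ => hx0 i,
      ENNReal.ofReal_prod_of_nonneg fun i _ => h0 i]
    gcongr
    exact ofReal_exp_le_expBinaryKL hN ht hp hp1 hr hs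
  · intro t _
    exact mul_nonneg (mul_nonneg (Finset.prod_nonneg fun i _ => mul_nonneg (hx0 i) hr.le)
      (Finset.prod_nonneg fun i _ => mul_nonneg (h0 i) hs.le)) (Real.exp_pos _).le

lemma lintegral_bernoulliExpKL_le {Z : Type*} [MeasurableSpace Z] (μ : Measure Z)
    [IsProbabilityMeasure μ] {N : ℕ} (hN : 0 < N) {f : Z → ℝ} (hf : Measurable f)
    (hf01 : ∀ z, f z ∈ Set.Icc (0 : ℝ) 1) :
    ∫⁻ S, bernoulliExpKL N (∫ z, f z ∂μ) (fun i => f (S i)) ∂(Measure.pi fun _ : Fin N => μ) ≤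
      ENNReal.ofReal (2 * √N) := by
  have hN0 : (0 : ℝ) < N := by positivity
  have hint : Integrable f μ :=
    Integrable.of_mem_Icc 0 1 hf.aemeasurable (ae_of_all _ hf01)
  set p := ∫ z, f z ∂μ with hp
  have hp1 : ∫⁻ z, ENNReal.ofReal (f z) ∂μ = ENNReal.ofReal p :=
    (ofReal_integral_eq_lintegral_ofReal hint (ae_of_all _ fun z => (hf01 z).1)).symm
  have hq1 : ∫⁻ z, ENNReal.ofReal (1 - f z) ∂μ = ENNReal.ofReal (1 - p) := by
    have hint1 : Integrable (fun z => 1 - f z) μ := (integrable_const 1).sub hint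
    rw [← ofReal_integral_eq_lintegral_ofReal hint1
      (ae_of_all _ fun z => sub_nonneg.2 (hf01 z).2), integral_sub (integrable_const 1) hint]
    simp [hp]
  have hprod : ∀ (t : Finset (Fin N)) (a b : Fin N → ℝ≥0∞),
      (∏ i ∈ t, a i) * ∏ i ∈ tᶜ, b i = ∏ i, if i ∈ t then a i else b i := by
    intro t a b
    rw [← Finset.prod_mul_prod_compl t fun i => if i ∈ t then a i else b i]
    congr 1
    · exact Finset.prod_congr rfl fun i hi => by simp [hi]
    · exact Finset.prod_congr rfl fun i hi => by simp [Finset.mem_compl.1 hi]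
  have hmeas : ∀ (t : Finset (Fin N)) (i : Fin N),
      Measurable fun z => if i ∈ t then ENNReal.ofReal (f z) else ENNReal.ofReal (1 - f z) := by
    intro t i
    split_ifs <;> fun_prop
  have hmeas' : ∀ (t : Finset (Fin N)) (i : Fin N), Measurable fun S : Fin N → Z =>
      if i ∈ t then ENNReal.ofReal (f (S i)) else ENNReal.ofReal (1 - f (S i)) :=
    fun t i => (hmeas t i).comp (measurable_pi_apply i)
  have hterm : ∀ t : Finset (Fin N),
      ∫⁻ S, (∏ i ∈ t, ENNReal.ofReal (f (S i))) * (∏ i ∈ tᶜ, ENNReal.ofReal (1 - f (S i)))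
        ∂(Measure.pi fun _ : Fin N => μ) =
      ENNReal.ofReal p ^ t.card * ENNReal.ofReal (1 - p) ^ (N - t.card) := by
    intro t
    simp_rw [hprod]
    rw [ProbabilityTheory.lintegral_prod_eq_prod_lintegral_of_indepFun _
      (fun i (S : Fin N → Z) =>
        if i ∈ t then ENNReal.ofReal (f (S i)) else ENNReal.ofReal (1 - f (S i)))
      (ProbabilityTheory.iIndepFun_pi (μ := fun _ : Fin N => μ)
        (fun i => (hmeas t i).aemeasurable)) (hmeas' t)]
    have hi : ∀ i, ∫⁻ S : Fin N → Z, (if i ∈ t then ENNReal.ofReal (f (S i)) else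
        ENNReal.ofReal (1 - f (S i))) ∂(Measure.pi fun _ : Fin N => μ) =
        if i ∈ t then ENNReal.ofReal p else ENNReal.ofReal (1 - p) := by
      intro i
      rw [(measurePreserving_eval (fun _ : Fin N => μ) i).lintegral_comp (hmeas t i)]
      split_ifs
      · exact hp1
      · exact hq1
    simp_rw [hi]
    rw [← hprod, Finset.prod_const, Finset.prod_const, Finset.card_compl, Fintype.card_fin]
  have hmode : ∀ k ≤ N, ENNReal.ofReal p ^ k * ENNReal.ofReal (1 - p) ^ (N - k) *
      expBinaryKL N p k ≤
      ENNReal.ofReal (((k : ℝ) / N) ^ k * (((N - k : ℕ) : ℝ) / N) ^ (N - k)) := by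
    intro k _
    have hcast : ∀ m : ℕ, (m / N : ℝ≥0∞) = ENNReal.ofReal (m / N) := fun m => by
      rw [ENNReal.ofReal_div_of_pos hN0, ENNReal.ofReal_natCast, ENNReal.ofReal_natCast]
    rw [expBinaryKL, mul_mul_mul_comm, ← mul_pow, ← mul_pow, ENNReal.ofReal_mul (by positivity),
      ENNReal.ofReal_pow (by positivity), ENNReal.ofReal_pow (by positivity), ← hcast, ← hcast]
    gcongr <;> exact ENNReal.mul_div_le
  simp only [bernoulliExpKL]
  rw [lintegral_finsetSum]
  · simp_rw [hprod]
    calc ∑ t : Finset (Fin N), ∫⁻ S : Fin N → Z, (∏ i, if i ∈ t then ENNReal.ofReal (f (S i)) else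
          ENNReal.ofReal (1 - f (S i))) * expBinaryKL N p t.card ∂(Measure.pi fun _ : Fin N => μ)
      _ ≤ ∑ t : Finset (Fin N), ENNReal.ofReal (((t.card : ℝ) / N) ^ t.card *
          (((N - t.card : ℕ) : ℝ) / N) ^ (N - t.card)) := by
        refine Finset.sum_le_sum fun t _ => ?_
        rw [lintegral_mul_const _ (Finset.measurable_prod _ fun i _ => hmeas' t i)]
        simp_rw [← hprod]
        rw [hterm]
        exact hmode _ (by simpa using Finset.card_le_univ t)
      _ = ENNReal.ofReal (∑ k ∈ Finset.range (N + 1),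
          (N.choose k : ℝ) * (((k : ℝ) / N) ^ k * (((N - k : ℕ) : ℝ) / N) ^ (N - k))) := by
        rw [← ENNReal.ofReal_sum_of_nonneg fun _ _ => by positivity, ← Finset.powerset_univ,
          Finset.sum_powerset_apply_card
            (fun k => ((k : ℝ) / N) ^ k * (((N - k : ℕ) : ℝ) / N) ^ (N - k))]
        simp
      _ ≤ ENNReal.ofReal (2 * √N) := ENNReal.ofReal_le_ofReal (sum_binomial_mode_le hN)
  · intro t _
    simp_rw [hprod]
    exact (Finset.measurable_prod _ fun i _ => hmeas' t i).mul_const _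

/-- The Donsker–Varadhan change of measure inequality. -/
lemma integral_le_integral_llr_add_log {α : Type*} [MeasurableSpace α] {Q P : Measure α}
    [IsProbabilityMeasure Q] [IsProbabilityMeasure P] (hQP : Q ≪ P)
    (hllr : Integrable (llr Q P) Q) {f : α → ℝ} (hfQ : Integrable f Q)
    (hfP : Integrable (fun x => Real.exp (f x)) P) :
    ∫ x, f x ∂Q ≤ ∫ x, llr Q P x ∂Q + Real.log (∫ x, Real.exp (f x) ∂P) := by
  have := isProbabilityMeasure_tilted hfP
  have h := InformationTheory.integral_llr_add_sub_measure_univ_nonneg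
    (hQP.trans (absolutelyContinuous_tilted hfP)) (integrable_llr_tilted_right hQP hfQ hllr hfP)
  rw [integral_llr_tilted_right hQP hfQ hfP hllr] at h
  simp only [probReal_univ] at h
  linarith

lemma log_one_div_le_of_forall_pos {p B : ℝ} (hp : 0 < p) (hp1 : p < 1)
    (h : ∀ r s : ℝ, 0 < r → 0 < s → Real.log s + (1 - p * r - (1 - p) * s) ≤ B) :
    Real.log (1 / (1 - p)) ≤ B := by
  have hp' : 0 < 1 - p := sub_pos.2 hp1
  refine le_of_forall_pos_le_add fun ε hε => ?_
  have := h (ε / p) (1 / (1 - p)) (by positivity) (by positivity)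
  rw [mul_div_cancel₀ _ hp.ne', mul_div_cancel₀ _ hp'.ne'] at this
  linarith

lemma exists_lt_mul_log {q : ℝ} (hq : 0 < q) (B : ℝ) : ∃ r : ℝ, 0 < r ∧ B < q * Real.log r := by
  refine ⟨Real.exp ((B + 1) / q), Real.exp_pos _, ?_⟩
  rw [Real.log_exp, mul_div_cancel₀ _ hq.ne']
  linarith

/-- One half of the variational characterization of the binary divergence. -/
lemma bkl_le_ofReal {q p B : ℝ} (hq : q ∈ Set.Icc (0 : ℝ) 1) (hp : p ∈ Set.Icc (0 : ℝ) 1)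
    (h : ∀ r s : ℝ, 0 < r → 0 < s →
      q * Real.log r + (1 - q) * Real.log s + (1 - p * r - (1 - p) * s) ≤ B) :
    bkl q p ≤ ENNReal.ofReal B := by
  unfold bkl
  split_ifs with hqp hp01
  · exact zero_le
  · exfalso
    rcases hp01 with rfl | rfl
    · obtain ⟨r, hr, hB⟩ := exists_lt_mul_log (lt_of_le_of_ne hq.1 (Ne.symm hqp)) B
      have := h r 1 hr one_pos
      simp only [Real.log_one] at this
      linarith
    · obtain ⟨s, hs, hB⟩ := exists_lt_mul_log (sub_pos.2 (lt_of_le_of_ne hq.2 hqp)) B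
      have := h 1 s one_pos hs
      simp only [Real.log_one] at this
      linarith
  · rw [not_or] at hp01
    have hp0 : 0 < p := lt_of_le_of_ne hp.1 (Ne.symm hp01.1)
    have hp1 : p < 1 := lt_of_le_of_ne hp.2 hp01.2
    have hp' : 0 < 1 - p := sub_pos.2 hp1
    refine ENNReal.ofReal_le_ofReal ?_
    rcases hq.1.eq_or_lt with rfl | hq0
    · have := log_one_div_le_of_forall_pos hp0 hp1 (B := B) fun r s hr hs => by
        have := h r s hr hs
        linarith
      simpa using this
    rcases hq.2.eq_or_lt with rfl | hq1
    · have := log_one_div_le_of_forall_pos hp' (by linarith) (B := B) fun s r hs hr => by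
        have := h r s hr hs
        linarith
      simpa using this
    have hq' : 0 < 1 - q := sub_pos.2 hq1
    have := h (q / p) ((1 - q) / (1 - p)) (by positivity) (by positivity)
    rw [mul_div_cancel₀ _ hp0.ne', mul_div_cancel₀ _ hp'.ne'] at this
    linarith

lemma measurable_expBinaryKL (N k : ℕ) : Measurable fun p => expBinaryKL N p k := by
  unfold expBinaryKL
  fun_prop

lemma ofReal_one_sub_le_measure_le {α : Type*} [MeasurableSpace α] (ν : Measure α)
    [IsProbabilityMeasure ν] {M : α → ℝ≥0∞} (hM : Measurable M) {c δ : ℝ} (hc : 0 < c)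
    (hδ : 0 < δ) (h : ∫⁻ x, M x ∂ν ≤ ENNReal.ofReal c) :
    ENNReal.ofReal (1 - δ) ≤ ν {x | M x ≤ ENNReal.ofReal (c / δ)} := by
  have hset : MeasurableSet {x | M x ≤ ENNReal.ofReal (c / δ)} := hM measurableSet_Iic
  have hc' : 0 < c / δ := by positivity
  have hcompl : ν {x | M x ≤ ENNReal.ofReal (c / δ)}ᶜ ≤ ENNReal.ofReal δ := by
    calc ν {x | M x ≤ ENNReal.ofReal (c / δ)}ᶜ
      _ ≤ ν {x | ENNReal.ofReal (c / δ) ≤ M x} :=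
        measure_mono fun x (hx : ¬ M x ≤ ENNReal.ofReal (c / δ)) => (not_le.1 hx).le
      _ ≤ (∫⁻ x, M x ∂ν) / ENNReal.ofReal (c / δ) :=
        meas_ge_le_lintegral_div hM.aemeasurable (by simpa using hc') ENNReal.ofReal_ne_top
      _ ≤ ENNReal.ofReal c / ENNReal.ofReal (c / δ) := by gcongr
      _ = ENNReal.ofReal δ := by
        rw [← ENNReal.ofReal_div_of_pos hc']
        congr 1
        field_simp
  rw [ENNReal.ofReal_sub _ hδ.le, ENNReal.ofReal_one, tsub_le_iff_right]
  rw [prob_compl_eq_one_sub hset, tsub_le_iff_right, add_comm] at hcompl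
  exact hcompl

lemma bkl_integral_le {H : Type*} [MeasurableSpace H] {P Q : Measure H} [IsProbabilityMeasure P]
    [IsProbabilityMeasure Q] (hQP : Q ≪ P) (hllr : Integrable (llr Q P) Q) {N : ℕ} (hN : 0 < N)
    {q p : H → ℝ} (hq : Measurable q) (hp : Measurable p) (hq01 : ∀ h, q h ∈ Set.Icc (0 : ℝ) 1)
    (hp01 : ∀ h, p h ∈ Set.Icc (0 : ℝ) 1) {c : ℝ} (hc : 0 < c)
    (hexp : ∀ r s : ℝ, 0 < r → 0 < s → ∫⁻ h, ENNReal.ofReal (Real.exp (N * (q h * Real.log r +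
      (1 - q h) * Real.log s + (1 - p h * r - (1 - p h) * s)))) ∂P ≤ ENNReal.ofReal c) :
    bkl (∫ h, q h ∂Q) (∫ h, p h ∂Q) ≤
      ENNReal.ofReal ((∫ h, llr Q P h ∂Q + Real.log c) / N) := by
  have hN0 : (0 : ℝ) < N := by positivity
  have hqi : Integrable q Q := Integrable.of_mem_Icc 0 1 hq.aemeasurable (ae_of_all _ hq01)
  have hpi : Integrable p Q := Integrable.of_mem_Icc 0 1 hp.aemeasurable (ae_of_all _ hp01)
  have hmem : ∀ {u : H → ℝ}, Integrable u Q → (∀ h, u h ∈ Set.Icc (0 : ℝ) 1) →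
      ∫ h, u h ∂Q ∈ Set.Icc (0 : ℝ) 1 := fun {u} hu hu01 =>
    ⟨integral_nonneg fun h => (hu01 h).1, by
      simpa using integral_mono hu (integrable_const (1 : ℝ)) fun h => (hu01 h).2⟩
  refine bkl_le_ofReal (hmem hqi hq01) (hmem hpi hp01) fun r s hr hs => ?_
  set f : H → ℝ := fun h => N * (q h * Real.log r +
      (1 - q h) * Real.log s + (1 - p h * r - (1 - p h) * s)) with hf
  have hf' : f = fun h => N * (Real.log r - Real.log s) * q h + N * (s - r) * p h +
      N * (Real.log s + 1 - s) := by
    funext h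
    simp only [hf]
    ring
  have hfm : Measurable f := by fun_prop
  have hfQ : Integrable f Q := by
    rw [hf']
    exact ((hqi.const_mul _).add (hpi.const_mul _)).add (integrable_const _)
  have hfint : ∫ h, f h ∂Q = N * ((∫ h, q h ∂Q) * Real.log r +
      (1 - ∫ h, q h ∂Q) * Real.log s + (1 - (∫ h, p h ∂Q) * r - (1 - ∫ h, p h ∂Q) * s)) := by
    have hqp : Integrable (fun h => N * (Real.log r - Real.log s) * q h + N * (s - r) * p h) Q :=
      (hqi.const_mul _).add (hpi.const_mul _)
    simp only [hf']
    rw [integral_add hqp (integrable_const _), integral_add (hqi.const_mul _) (hpi.const_mul _),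
      integral_const_mul, integral_const_mul]
    simp only [integral_const, probReal_univ, smul_eq_mul]
    ring
  have hfP : Integrable (fun h => Real.exp (f h)) P := by
    refine ⟨(Real.measurable_exp.comp hfm).aestronglyMeasurable, ?_⟩
    rw [hasFiniteIntegral_iff_ofReal (ae_of_all _ fun h => (Real.exp_pos _).le)]
    exact (hexp r s hr hs).trans_lt ENNReal.ofReal_lt_top
  have hle : ∫ h, Real.exp (f h) ∂P ≤ c := by
    rw [← ENNReal.ofReal_le_ofReal_iff hc.le,
      ofReal_integral_eq_lintegral_ofReal hfP (ae_of_all _ fun h => (Real.exp_pos _).le)]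
    exact hexp r s hr hs
  have hDV := integral_le_integral_llr_add_log hQP hllr hfQ hfP
  have hlog := Real.log_le_log (integral_exp_pos hfP) hle
  rw [le_div_iff₀ hN0, mul_comm, ← hfint]
  linarith

/-- **PAC-Bayesian theorem.** With probability at least `1 − δ` over the i.i.d. training
sample `S ∼ μ^N`, simultaneously for all probability measures `Q` on the hypothesis space:
`kl(R_S(Q) ‖ R(Q)) ≤ (KL(Q‖P) + ln(2√N/δ)) / N`. -/
theorem pac_bayes_theorem
    {H X Y : Type*} [MeasurableSpace H] [MeasurableSpace X] [MeasurableSpace Y]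
    (ev : H → X → Y) (hev : Measurable fun p : H × X => ev p.1 p.2)
    (ℓ : Y → Y → ℝ) (hℓ : Measurable fun p : Y × Y => ℓ p.1 p.2)
    (hℓ01 : ∀ y y', ℓ y y' ∈ Set.Icc (0 : ℝ) 1)
    (μ : Measure (X × Y)) [IsProbabilityMeasure μ]
    (N : ℕ) (hN : 0 < N)
    (P : Measure H) [IsProbabilityMeasure P]
    (δ : ℝ) (hδ : 0 < δ) (hδ1 : δ ≤ 1) :
    ENNReal.ofReal (1 - δ) ≤
      (Measure.pi fun _ : Fin N => μ)
        {S | ∀ Q : Measure H, IsProbabilityMeasure Q →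
          bkl (∫ h, (N : ℝ)⁻¹ * ∑ i : Fin N, ℓ (S i).2 (ev h (S i).1) ∂Q)
              (∫ h, ∫ z, ℓ z.2 (ev h z.1) ∂μ ∂Q) ≤
            (klDiv Q P + ENNReal.ofReal (Real.log (2 * Real.sqrt N / δ))) / (N : ℝ≥0∞)} := by
  set g : H → X × Y → ℝ := fun h z => ℓ z.2 (ev h z.1) with hg
  have hgm : Measurable fun a : H × (X × Y) => g a.1 a.2 :=
    hℓ.comp ((measurable_snd.comp measurable_snd).prodMk
      (hev.comp (measurable_fst.prodMk (measurable_fst.comp measurable_snd))))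
  have hg01 : ∀ h z, g h z ∈ Set.Icc (0 : ℝ) 1 := fun h z => hℓ01 _ _
  have hgh : ∀ h, Measurable (g h) := fun h => hgm.comp measurable_prodMk_left
  have hgz : ∀ z, Measurable fun h => g h z := fun z => hgm.comp measurable_prodMk_right
  set R : H → ℝ := fun h => ∫ z, g h z ∂μ with hR
  have hRm : Measurable R := hgm.stronglyMeasurable.integral_prod_right.measurable
  have hR01 : ∀ h, R h ∈ Set.Icc (0 : ℝ) 1 := fun h =>
    ⟨integral_nonneg fun z => (hg01 h z).1, by
      simpa using integral_mono (Integrable.of_mem_Icc 0 1 (hgh h).aemeasurable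
        (ae_of_all μ (hg01 h))) (integrable_const (1 : ℝ)) fun z => (hg01 h z).2⟩
  set ν : Measure (Fin N → X × Y) := Measure.pi fun _ => μ
  have hK : Measurable fun a : (Fin N → X × Y) × H =>
      bernoulliExpKL N (R a.2) fun i => g a.2 (a.1 i) := by
    have hgi : ∀ i, Measurable fun a : (Fin N → X × Y) × H => g a.2 (a.1 i) := fun i =>
      hgm.comp (measurable_snd.prodMk ((measurable_pi_apply i).comp measurable_fst))
    refine Finset.measurable_sum _ fun t _ => Measurable.mul (Measurable.mul
      (Finset.measurable_prod _ fun i _ => (hgi i).ennreal_ofReal)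
      (Finset.measurable_prod _ fun i _ => (measurable_const.sub (hgi i)).ennreal_ofReal))
      ((measurable_expBinaryKL N _).comp (hRm.comp measurable_snd))
  have hmoment : ∫⁻ S, ∫⁻ h, bernoulliExpKL N (R h) (fun i => g h (S i)) ∂P ∂ν ≤
      ENNReal.ofReal (2 * √N) := by
    rw [lintegral_lintegral_swap hK.aemeasurable]
    calc _ ≤ ∫⁻ _, ENNReal.ofReal (2 * √N) ∂P :=
          lintegral_mono fun h => lintegral_bernoulliExpKL_le μ hN (hgh h) (hg01 h)
      _ = _ := by simp
  have hsqrt : 1 ≤ √(N : ℝ) := Real.one_le_sqrt.2 (by exact_mod_cast hN)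
  refine (ofReal_one_sub_le_measure_le ν hK.lintegral_prod_right' (by positivity) hδ
    hmoment).trans (measure_mono fun S hS Q hQ => ?_)
  have hN0 : (0 : ℝ) < N := by positivity
  by_cases hfin : Q ≪ P ∧ Integrable (llr Q P) Q
  swap
  · rw [klDiv, if_neg hfin, top_add, ENNReal.top_div_of_ne_top (ENNReal.natCast_ne_top N)]
    exact le_top
  have hlog : 0 ≤ Real.log (2 * √N / δ) :=
    Real.log_nonneg ((one_le_div hδ).2 (by linarith))
  have hkl : 0 ≤ ∫ h, llr Q P h ∂Q := by
    simpa using integral_le_integral_llr_add_log hfin.1 hfin.2 (f := fun _ => (0 : ℝ))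
      (integrable_const _) (integrable_const _)
  rw [klDiv, if_pos hfin, ← ENNReal.ofReal_add hkl hlog, ← ENNReal.ofReal_natCast,
    ← ENNReal.ofReal_div_of_pos hN0]
  refine bkl_integral_le hfin.1 hfin.2 hN (q := fun h => (N : ℝ)⁻¹ * ∑ i, g h (S i))
    ((Finset.measurable_sum _ fun i _ => hgz (S i)).const_mul _) hRm (fun h => ⟨?_, ?_⟩) hR01
    (by positivity) fun r s hr hs => ?_
  · exact mul_nonneg (by positivity) (Finset.sum_nonneg fun i _ => (hg01 h (S i)).1)
  · rw [inv_mul_le_iff₀ hN0, mul_one]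
    simpa using Finset.sum_le_sum fun i (_ : i ∈ Finset.univ) => (hg01 h (S i)).2
  · exact (lintegral_mono fun h => ofReal_exp_le_bernoulliExpKL hN (hR01 h).1 (hR01 h).2 hr hs
      fun i => hg01 h (S i)).trans hS
end

section
/- (KL divergence against a countable mixture.) Let Θ be a countable set, p_θ a probability distribution on Θ, {P^θ}_{θ∈Θ} a family of probability measures on a measurable space, and define the mixture P := Σ_{θ∈Θ} p_θ P^θ. Then for every probability measure Q on the same space and every θ ∈ Θ with p_θ > 0: KL(Q‖P) ≤ ln(1/p_θ) + KL(Q‖P^θ). -/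
open MeasureTheory ENNReal NNReal
open scoped Classical

/-- If `c • P ≤ M`, then `log (dQ/dM) ≤ log (1/c) + log (dQ/dP)` holds `Q`-almost everywhere. -/
lemma llr_le_log_inv_add_llr_of_smul_le {α : Type*} [MeasurableSpace α] {Q P M : Measure α}
    [SigmaFinite Q] [IsFiniteMeasure P] [IsFiniteMeasure M] {c : ℝ≥0∞} (hc : c ≠ 0)
    (hc_top : c ≠ ⊤) (hQP : Q ≪ P) (hPM : c • P ≤ M) :
    ∀ᵐ x ∂Q, llr Q M x ≤ Real.log (1 / c.toReal) + llr Q P x := by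
  have hPM_ac : P ≪ M :=
    (Measure.absolutelyContinuous_smul hc).trans (Measure.absolutelyContinuous_of_le hPM)
  have hQM : Q ≪ M := hQP.trans hPM_ac
  filter_upwards [hQM.ae_le (Measure.rnDeriv_mul_rnDeriv hQP (κ := M)),
    hQM.ae_le (Measure.rnDeriv_le_one_of_le hPM),
    hQM.ae_le (Measure.rnDeriv_smul_left_of_ne_top' P M hc_top),
    Measure.rnDeriv_pos hQM, hQM.ae_le (Measure.rnDeriv_lt_top Q M)] with x h_mul h_le h_smul h_pos h_lt
  have h_toReal : (Q.rnDeriv M x).toReal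
      = (Q.rnDeriv P x).toReal * (P.rnDeriv M x).toReal := by
    rw [← ENNReal.toReal_mul, ← h_mul, Pi.mul_apply]
  have h_ne : (Q.rnDeriv P x).toReal * (P.rnDeriv M x).toReal ≠ 0 :=
    h_toReal ▸ (ENNReal.toReal_pos h_pos.ne' h_lt.ne).ne'
  have h_le' : c.toReal * (P.rnDeriv M x).toReal ≤ 1 := by
    rw [← ENNReal.toReal_mul]
    refine ENNReal.toReal_le_of_le_ofReal zero_le_one ?_
    rw [h_smul] at h_le
    simpa using h_le
  have hc_pos : 0 < c.toReal := ENNReal.toReal_pos hc hc_top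
  have h_log : Real.log (P.rnDeriv M x).toReal ≤ Real.log (1 / c.toReal) := by
    refine Real.log_le_log
      (lt_of_le_of_ne ENNReal.toReal_nonneg (right_ne_zero_of_mul h_ne).symm) ?_
    rwa [le_div_iff₀' hc_pos]
  simp only [llr_def]
  rw [h_toReal, Real.log_mul (left_ne_zero_of_mul h_ne) (right_ne_zero_of_mul h_ne)]
  linarith

/-- A log-likelihood ratio `llr Q M` that is bounded above by a `Q`-integrable function is
`Q`-integrable: its negative part is controlled by `exp (-llr Q M) = dM/dQ`. -/
lemma integrable_llr_of_ae_le {α : Type*} [MeasurableSpace α] {Q M : Measure α}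
    [SigmaFinite Q] [IsFiniteMeasure M] (hQM : Q ≪ M) {g : α → ℝ} (hg : Integrable g Q)
    (h_le : ∀ᵐ x ∂Q, llr Q M x ≤ g x) : Integrable (llr Q M) Q := by
  refine (hg.abs.add (Measure.integrable_toReal_rnDeriv (μ := M) (ν := Q))).mono'
    (measurable_llr Q M).aestronglyMeasurable ?_
  filter_upwards [h_le, exp_neg_llr hQM] with x hx h_exp
  have h_exp_ge := Real.add_one_le_exp (-llr Q M x)
  rw [h_exp] at h_exp_ge
  rw [Real.norm_eq_abs, Pi.add_apply, abs_le]
  have h_nonneg : 0 ≤ (M.rnDeriv Q x).toReal := ENNReal.toReal_nonneg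
  have := le_abs_self (g x)
  have := abs_nonneg (g x)
  constructor <;> linarith

/-- If `c • P ≤ M`, then `KL(Q‖M) ≤ log (1/c) + KL(Q‖P)`. -/
lemma klDiv_le_log_inv_add_klDiv_of_smul_le {α : Type*} [MeasurableSpace α] {Q P M : Measure α}
    [IsProbabilityMeasure Q] [IsFiniteMeasure P] [IsFiniteMeasure M] {c : ℝ≥0∞} (hc : c ≠ 0)
    (hc_top : c ≠ ⊤) (hPM : c • P ≤ M) :
    klDiv Q M ≤ ENNReal.ofReal (Real.log (1 / c.toReal)) + klDiv Q P := by
  by_cases h : Q ≪ P ∧ Integrable (llr Q P) Q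
  swap
  · simp [klDiv, if_neg h]
  obtain ⟨hQP, h_int⟩ := h
  have hQM : Q ≪ M := hQP.trans <|
    (Measure.absolutelyContinuous_smul hc).trans (Measure.absolutelyContinuous_of_le hPM)
  have h_le := llr_le_log_inv_add_llr_of_smul_le hc hc_top hQP hPM
  have hg : Integrable (fun x ↦ Real.log (1 / c.toReal) + llr Q P x) Q :=
    (integrable_const _).add h_int
  have h_int' := integrable_llr_of_ae_le hQM hg h_le
  rw [klDiv, klDiv, if_pos ⟨hQM, h_int'⟩, if_pos ⟨hQP, h_int⟩]
  refine le_trans (ENNReal.ofReal_le_ofReal ?_) ENNReal.ofReal_add_le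
  calc ∫ x, llr Q M x ∂Q
      ≤ ∫ x, (Real.log (1 / c.toReal) + llr Q P x) ∂Q := integral_mono_ae h_int' hg h_le
    _ = Real.log (1 / c.toReal) + ∫ x, llr Q P x ∂Q := by
      rw [integral_add (integrable_const _) h_int]
      simp

/-- **KL divergence against a countable mixture.** If `P = Σ_θ p_θ P^θ` is a countable mixture
of probability measures, then for every probability measure `Q` and every `θ` with `p_θ > 0`:
`KL(Q‖P) ≤ ln(1/p_θ) + KL(Q‖P^θ)`. -/
theorem klDiv_le_log_inv_add_klDiv_of_mixture
    {α : Type*} [MeasurableSpace α]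
    {Θ : Type*} [Countable Θ] (pθ : Θ → ℝ≥0∞) (hpθ : ∑' θ, pθ θ = 1)
    (P : Θ → Measure α) (hP : ∀ θ, IsProbabilityMeasure (P θ))
    (Q : Measure α) [IsProbabilityMeasure Q]
    (θ : Θ) (hθ : 0 < pθ θ) :
    klDiv Q (Measure.sum fun θ' => pθ θ' • P θ') ≤
      ENNReal.ofReal (Real.log (1 / (pθ θ).toReal)) + klDiv Q (P θ) := by
  have hM : IsProbabilityMeasure (Measure.sum fun θ' => pθ θ' • P θ') :=
    ⟨by simp [Measure.sum_apply, hpθ]⟩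
  have hc_top : pθ θ ≠ ⊤ := ENNReal.ne_top_of_tsum_ne_top (hpθ ▸ ENNReal.one_ne_top) θ
  exact klDiv_le_log_inv_add_klDiv_of_smul_le hθ.ne' hc_top
    (Measure.le_sum (fun θ' => pθ θ' • P θ') θ)
end

section
/- (KL divergence is unchanged by composing with a common conditional.) Let μ and ν be probability measures on a measurable space α and let κ be a Markov kernel from α to a measurable space β. Then KL(μ ⊗ κ ‖ ν ⊗ κ) = KL(μ ‖ ν), where μ ⊗ κ denotes the joint measure on α × β with first marginal μ and conditional κ. In particular, if two measures P and Q on a product space share the same conditional distribution of the second component given the first, their KL divergence equals the KL divergence of their first marginals. -/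
open MeasureTheory ProbabilityTheory ENNReal NNReal
open scoped Classical

theorem klDiv_eq_informationTheory_klDiv {α : Type*} [MeasurableSpace α]
    (Q P : Measure α) [IsProbabilityMeasure Q] [IsProbabilityMeasure P] :
    klDiv Q P = InformationTheory.klDiv Q P := by
  simp [klDiv, InformationTheory.klDiv_def]

/-- **KL divergence is unchanged by composing with a common conditional (Markov kernel).**
`KL(μ ⊗ κ ‖ ν ⊗ κ) = KL(μ ‖ ν)`; in particular, if two measures on a product space share the
same conditional distribution of the second component given the first, then their KL divergence
equals the KL divergence of their first marginals. -/
theorem klDiv_compProd_kernel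
    {α β : Type*} [MeasurableSpace α] [MeasurableSpace β]
    [MeasurableSpace.CountablyGenerated β]
    (μ ν : Measure α) [IsProbabilityMeasure μ] [IsProbabilityMeasure ν]
    (κ : Kernel α β) [IsMarkovKernel κ] :
    klDiv (μ ⊗ₘ κ) (ν ⊗ₘ κ) = klDiv μ ν ∧
    ∀ (Q P : Measure (α × β)), IsProbabilityMeasure Q → IsProbabilityMeasure P →
      Q = Q.fst ⊗ₘ κ → P = P.fst ⊗ₘ κ → klDiv Q P = klDiv Q.fst P.fst := by
  have klDiv_compProd (μ' ν' : Measure α) [IsProbabilityMeasure μ'] [IsProbabilityMeasure ν'] :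
      klDiv (μ' ⊗ₘ κ) (ν' ⊗ₘ κ) = klDiv μ' ν' := by
    simp only [klDiv_eq_informationTheory_klDiv, InformationTheory.klDiv_compProd_left]
  refine ⟨klDiv_compProd μ ν, fun Q P _ _ hQ hP ↦ ?_⟩
  calc klDiv Q P = klDiv (Q.fst ⊗ₘ κ) (P.fst ⊗ₘ κ) := by rw [← hQ, ← hP]
    _ = klDiv Q.fst P.fst := klDiv_compProd Q.fst P.fst
end

section
/- (Characterization of the inverse binary KL divergence.) For every q ∈ [0,1) and every ε ∈ [0,∞), there exists a unique p ∈ [q,1) with kl(q‖p) = ε, and this p equals kl⁻¹(q,ε) := max{p ∈ [0,1] : kl(q‖p) ≤ ε}; in particular the maximum defining kl⁻¹(q,ε) is attained. -/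
open MeasureTheory ENNReal NNReal
open scoped Classical

/-- Inverse binary KL divergence `kl⁻¹(q,ε) = max{p ∈ [0,1] : kl(q‖p) ≤ ε}`
(defined as a supremum; its attainment is part of the theorem below). -/
noncomputable def klInv (q : ℝ) (ε : ℝ≥0∞) : ℝ :=
  sSup {p | p ∈ Set.Icc (0 : ℝ) 1 ∧ bkl q p ≤ ε}

/-- The real-valued formula for `kl(q‖p)` with the logarithms of quotients expanded. -/
noncomputable def bklReal (q p : ℝ) : ℝ :=
  q * Real.log q + (1 - q) * Real.log (1 - q) - q * Real.log p - (1 - q) * Real.log (1 - p)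

theorem bklReal_self (q : ℝ) : bklReal q q = 0 := by
  unfold bklReal; ring

theorem bkl_eq_ofReal_bklReal {q p : ℝ} (hq : 0 ≤ q) (hp : p ∈ Set.Ico q 1) :
    bkl q p = ENNReal.ofReal (bklReal q p) := by
  obtain ⟨hqp, hp1⟩ := hp
  unfold bkl
  split_ifs with h h'
  · rw [← h, bklReal_self, ENNReal.ofReal_zero]
  · have := lt_of_le_of_ne hqp h
    rcases h' with h' | h' <;> linarith
  · have hlt := lt_of_le_of_ne hqp h
    have h1 : Real.log ((1 - q) / (1 - p)) = Real.log (1 - q) - Real.log (1 - p) :=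
      Real.log_div (by linarith) (by linarith)
    have h2 : q * Real.log (q / p) = q * Real.log q - q * Real.log p := by
      rcases hq.eq_or_lt with rfl | hq
      · simp
      · rw [Real.log_div hq.ne' (hq.trans hlt).ne']; ring
    rw [h1, h2, bklReal]
    congr 1; ring

theorem continuousOn_bklReal {q : ℝ} (hq : 0 ≤ q) :
    ContinuousOn (bklReal q) (Set.Ico q 1) := by
  have h1 : ContinuousOn (fun p : ℝ => (1 - q) * Real.log (1 - p)) (Set.Ico q 1) :=
    continuousOn_const.mul
      (ContinuousOn.log (by fun_prop) fun p hp => (sub_pos.2 hp.2).ne')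
  have h2 : ContinuousOn (fun p : ℝ => q * Real.log p) (Set.Ico q 1) := by
    rcases hq.eq_or_lt with rfl | hq
    · simpa using continuousOn_const
    · exact continuousOn_const.mul
        (continuousOn_id.log fun p hp => (hq.trans_le hp.1).ne')
  exact (continuousOn_const.sub h2).sub h1

theorem hasDerivAt_bklReal (q : ℝ) {p : ℝ} (hp0 : 0 < p) (hp1 : p < 1) :
    HasDerivAt (bklReal q) ((p - q) / (p * (1 - p))) p := by
  have h1p : 1 - p ≠ 0 := (sub_pos.2 hp1).ne'
  have h := (((Real.hasDerivAt_log hp0.ne').const_mul q).const_sub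
    (q * Real.log q + (1 - q) * Real.log (1 - q))).sub
    ((((hasDerivAt_id p).const_sub 1).log h1p).const_mul (1 - q))
  refine h.congr_deriv ?_
  have := hp0.ne'
  simp only [id]
  field_simp
  ring

theorem strictMonoOn_bklReal {q : ℝ} (hq : 0 ≤ q) :
    StrictMonoOn (bklReal q) (Set.Ico q 1) := by
  refine strictMonoOn_of_deriv_pos (convex_Ico q 1) (continuousOn_bklReal hq) fun p hp => ?_
  rw [interior_Ico] at hp
  have hp0 : 0 < p := hq.trans_lt hp.1
  rw [(hasDerivAt_bklReal q hp0 hp.2).deriv]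
  exact div_pos (sub_pos.2 hp.1) (mul_pos hp0 (sub_pos.2 hp.2))

theorem exists_le_bklReal {q ε : ℝ} (hq : q ∈ Set.Ico (0 : ℝ) 1) (hε : 0 ≤ ε) :
    ∃ p ∈ Set.Ico q 1, ε ≤ bklReal q p := by
  obtain ⟨hq0, hq1⟩ := hq
  have h1q : 0 < 1 - q := sub_pos.2 hq1
  have hlog : q * Real.log q ≤ 0 :=
    mul_nonpos_of_nonneg_of_nonpos hq0 (Real.log_nonpos hq0 hq1.le)
  set t := (ε - q * Real.log q) / (1 - q) with ht
  have ht0 : 0 ≤ t := div_nonneg (by linarith) h1q.le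
  have hexp : Real.exp (-t) ≤ 1 := Real.exp_le_one_iff.2 (by linarith)
  have hpos : 0 < (1 - q) * Real.exp (-t) := mul_pos h1q (Real.exp_pos _)
  have hle : (1 - q) * Real.exp (-t) ≤ 1 - q := mul_le_of_le_one_right h1q.le hexp
  refine ⟨1 - (1 - q) * Real.exp (-t), ⟨by linarith, by linarith⟩, ?_⟩
  have hlogp : q * Real.log (1 - (1 - q) * Real.exp (-t)) ≤ 0 :=
    mul_nonpos_of_nonneg_of_nonpos hq0 (Real.log_nonpos (by linarith) (by linarith))
  have hlog1p : Real.log (1 - (1 - (1 - q) * Real.exp (-t))) = Real.log (1 - q) - t := by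
    rw [_root_.sub_sub_cancel, Real.log_mul h1q.ne' (Real.exp_ne_zero _), Real.log_exp]; ring
  have hmul : (1 - q) * t = ε - q * Real.log q := by
    rw [ht]; field_simp
  rw [bklReal, hlog1p]
  linarith

theorem exists_bklReal_eq {q ε : ℝ} (hq : q ∈ Set.Ico (0 : ℝ) 1) (hε : 0 ≤ ε) :
    ∃ p ∈ Set.Ico q 1, bklReal q p = ε := by
  obtain ⟨r, hr, hεr⟩ := exists_le_bklReal hq hε
  have hsub : Set.Icc q r ⊆ Set.Ico q 1 := Set.Icc_subset_Ico_right hr.2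
  obtain ⟨p, hp, hpε⟩ := intermediate_value_Icc hr.1 ((continuousOn_bklReal hq.1).mono hsub)
    ⟨(bklReal_self q).le.trans hε, hεr⟩
  exact ⟨p, hsub hp, hpε⟩

theorem isGreatest_of_bklReal_eq {q p ε : ℝ} (hq : 0 ≤ q) (hp : p ∈ Set.Ico q 1)
    (hε : 0 ≤ ε) (h : bklReal q p = ε) :
    IsGreatest {p | p ∈ Set.Icc (0 : ℝ) 1 ∧ bkl q p ≤ ENNReal.ofReal ε} p := by
  refine ⟨⟨⟨hq.trans hp.1, hp.2.le⟩, ?_⟩, ?_⟩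
  · rw [bkl_eq_ofReal_bklReal hq hp, h]
  · rintro r ⟨⟨-, hr1⟩, hr⟩
    by_contra! hpr
    rcases hr1.eq_or_lt with rfl | hr1
    · have hq1 : q ≠ 1 := (hp.1.trans_lt hp.2).ne
      simp [bkl, hq1] at hr
    · have hrmem : r ∈ Set.Ico q 1 := ⟨hp.1.trans hpr.le, hr1⟩
      rw [bkl_eq_ofReal_bklReal hq hrmem, ENNReal.ofReal_le_ofReal_iff hε, ← h] at hr
      exact hr.not_gt (strictMonoOn_bklReal hq hp hrmem hpr)

/-- **Characterization of the inverse binary KL divergence.** For `q ∈ [0,1)` and `ε ∈ [0,∞)`,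
there is a unique `p ∈ [q,1)` with `kl(q‖p) = ε`; this `p` equals `kl⁻¹(q,ε)`, which moreover
is the attained maximum of the set `{p ∈ [0,1] : kl(q‖p) ≤ ε}`. -/
theorem klInv_characterization (q ε : ℝ) (hq : q ∈ Set.Ico (0 : ℝ) 1) (hε : 0 ≤ ε) :
    (∃! p : ℝ, p ∈ Set.Ico q 1 ∧ bkl q p = ENNReal.ofReal ε) ∧
    klInv q (ENNReal.ofReal ε) ∈ Set.Ico q 1 ∧
    bkl q (klInv q (ENNReal.ofReal ε)) = ENNReal.ofReal ε ∧
    klInv q (ENNReal.ofReal ε) ∈ {p | p ∈ Set.Icc (0 : ℝ) 1 ∧ bkl q p ≤ ENNReal.ofReal ε} ∧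
    ∀ p ∈ {p | p ∈ Set.Icc (0 : ℝ) 1 ∧ bkl q p ≤ ENNReal.ofReal ε},
      p ≤ klInv q (ENNReal.ofReal ε) := by
  obtain ⟨p, hp, hpε⟩ := exists_bklReal_eq hq hε
  have hgr := isGreatest_of_bklReal_eq hq.1 hp hε hpε
  have hkl : bkl q p = ENNReal.ofReal ε := by rw [bkl_eq_ofReal_bklReal hq.1 hp, hpε]
  have hinv : klInv q (ENNReal.ofReal ε) = p := hgr.csSup_eq
  rw [hinv]
  refine ⟨⟨p, ⟨hp, hkl⟩, ?_⟩, hp, hkl, hgr.1, hgr.2⟩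
  rintro r ⟨hr, hrε⟩
  have hmono := strictMonoOn_bklReal hq.1
  have hr0 : 0 ≤ bklReal q r := by
    rw [← bklReal_self q]
    exact hmono.monotoneOn ⟨le_rfl, hq.2⟩ hr hr.1
  rw [bkl_eq_ofReal_bklReal hq.1 hr, ENNReal.ofReal_eq_ofReal_iff hr0 hε] at hrε
  exact hmono.injOn hr hp (hrε.trans hpε.symm)
end

section
/- (Bayes risk is at most twice the Gibbs risk at a point.) Let ν be a probability measure on ℝ that is symmetric about a point m ∈ ℝ (i.e. the pushforward of ν under v ↦ 2m − v equals ν), and let f : ℝ → [0,1] be a measurable quasi-convex function (all sublevel sets {v : f(v) ≤ c} are convex, i.e. intervals). Then f(m) ≤ 2 ∫ f(v) dν(v). -/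
open MeasureTheory

/-- If all sublevel sets of `f` are convex, the value of `f` at a point is at most the larger of
its values at two points reflected through it. -/
theorem le_max_reflection_of_convex_sublevel {f : ℝ → ℝ}
    (hquasi : ∀ c : ℝ, Convex ℝ {v | f v ≤ c}) (m v : ℝ) :
    f m ≤ max (f v) (f (2 * m - v)) := by
  have h := hquasi (max (f v) (f (2 * m - v))) (le_max_left (f v) _) (le_max_right _ (f (2 * m - v)))
    (by norm_num : (0 : ℝ) ≤ 1 / 2) (by norm_num : (0 : ℝ) ≤ 1 / 2) (by norm_num)
  have hmid : (1 / 2 : ℝ) • v + (1 / 2 : ℝ) • (2 * m - v) = m := by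
    simp only [smul_eq_mul]; ring
  rwa [hmid] at h

/-- **Bayes risk is at most twice the Gibbs risk at a point.** If `ν` is a probability measure
on `ℝ` symmetric about `m` and `f : ℝ → [0,1]` is measurable and quasi-convex
(all sublevel sets are convex), then `f(m) ≤ 2 ∫ f dν`. -/
theorem bayes_risk_le_two_gibbs_risk
    (ν : Measure ℝ) [IsProbabilityMeasure ν] (m : ℝ)
    (hsym : ν.map (fun v => 2 * m - v) = ν)
    (f : ℝ → ℝ) (hf : Measurable f)
    (hf01 : ∀ v, f v ∈ Set.Icc (0 : ℝ) 1)
    (hquasi : ∀ c : ℝ, Convex ℝ {v | f v ≤ c}) :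
    f m ≤ 2 * ∫ v, f v ∂ν := by
  have hint : Integrable f ν :=
    .of_mem_Icc 0 1 hf.aemeasurable (.of_forall hf01)
  have hrefl : Measurable fun v : ℝ => 2 * m - v := by fun_prop
  have hint' : Integrable (fun v => f (2 * m - v)) ν :=
    .of_mem_Icc 0 1 (hf.comp hrefl).aemeasurable (.of_forall fun v => hf01 _)
  have heq : ∫ v, f (2 * m - v) ∂ν = ∫ v, f v ∂ν := by
    rw [← integral_map hrefl.aemeasurable hf.aestronglyMeasurable, hsym]
  calc f m = ∫ _, f m ∂ν := by simp
    _ ≤ ∫ v, (f v + f (2 * m - v)) ∂ν :=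
      integral_mono (integrable_const _) (hint.add hint') fun v =>
        (le_max_reflection_of_convex_sublevel hquasi m v).trans
          (max_le_add_of_nonneg (hf01 v).1 (hf01 _).1)
    _ = 2 * ∫ v, f v ∂ν := by rw [integral_add hint hint', heq, two_mul]
end

section
/- (KL divergence between multivariate Gaussians with the same-dimensional positive-definite covariances.) Let M be a positive natural number, a, m ∈ ℝ^M, and let B, K ∈ ℝ^{M×M} be symmetric positive definite matrices. Then KL( N(a, B) ‖ N(m, K) ) = −(1/2) ln det(B K⁻¹) + (1/2) tr(B K⁻¹) − M/2 + (1/2) (a − m)ᵀ K⁻¹ (a − m), where N(a,B) denotes the multivariate Gaussian measure on ℝ^M with mean a and covariance B. -/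
open MeasureTheory Matrix ENNReal NNReal
open scoped Classical

/-- The multivariate Gaussian measure `N(a, B)` on `ℝ^M`, given by the density
`(2π)^{−M/2} det(B)^{−1/2} exp(−(1/2)(x−a)ᵀ B⁻¹ (x−a))` with respect to Lebesgue measure. -/
noncomputable def mvGaussian {M : ℕ} (a : Fin M → ℝ) (B : Matrix (Fin M) (Fin M) ℝ) :
    Measure (Fin M → ℝ) :=
  volume.withDensity fun x =>
    ENNReal.ofReal ((2 * Real.pi) ^ (-(M : ℝ) / 2) * B.det ^ (-(1 : ℝ) / 2) *
      Real.exp (-(1 / 2) * ((x - a) ⬝ᵥ B⁻¹ *ᵥ (x - a))))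

namespace MvGaussian

open ProbabilityTheory

/-- The standard Gaussian measure on `ι → ℝ`. -/
noncomputable def stdGaussianPi (ι : Type*) [Fintype ι] : Measure (ι → ℝ) :=
  Measure.pi fun _ => gaussianReal 0 1

instance {ι : Type*} [Fintype ι] : IsProbabilityMeasure (stdGaussianPi ι) := by
  unfold stdGaussianPi; infer_instance

/-- A finite power of a measure with integrable density `f` has density `∏ i, f (x i)`. -/
lemma pi_withDensity_ofReal {ι : Type*} [Fintype ι] {f : ℝ → ℝ} (hf : Integrable f)
    (hf0 : ∀ x, 0 ≤ f x) :
    Measure.pi (fun _ : ι => (volume : Measure ℝ).withDensity fun x => ENNReal.ofReal (f x)) =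
      (volume : Measure (ι → ℝ)).withDensity fun x => ENNReal.ofReal (∏ i, f (x i)) := by
  refine Measure.pi_eq fun s hs => ?_
  rw [withDensity_apply _ (.univ_pi hs), ← lintegral_indicator (.univ_pi hs)]
  have hint (i : ι) : Integrable ((s i).indicator f) := hf.indicator (hs i)
  have hnonneg (i : ι) (x : ℝ) : 0 ≤ (s i).indicator f x :=
    Set.indicator_nonneg (fun x _ => hf0 x) x
  have hprod (x : ι → ℝ) :
      (Set.univ.pi s).indicator (fun x => ENNReal.ofReal (∏ i, f (x i))) x =
        ENNReal.ofReal (∏ i, (s i).indicator f (x i)) := by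
    by_cases hx : x ∈ Set.univ.pi s
    · rw [Set.indicator_of_mem hx]
      congr 1
      exact Finset.prod_congr rfl fun i _ =>
        (Set.indicator_of_mem (hx i (Set.mem_univ i)) f).symm
    · rw [Set.indicator_of_notMem hx]
      obtain ⟨i, hi⟩ : ∃ i, x i ∉ s i := by simpa [Set.mem_pi] using hx
      rw [Finset.prod_eq_zero (Finset.mem_univ i) (Set.indicator_of_notMem hi f),
        ENNReal.ofReal_zero]
  have hprodint : Integrable fun x : ι → ℝ => ∏ i, (s i).indicator f (x i) := .fintype_prod hint
  simp_rw [hprod]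
  rw [← ofReal_integral_eq_lintegral_ofReal hprodint
      (ae_of_all _ fun x => Finset.prod_nonneg fun i _ => hnonneg i (x i)),
    integral_fintype_prod_volume_eq_prod fun i => (s i).indicator f,
    ENNReal.ofReal_prod_of_nonneg fun i _ => integral_nonneg (hnonneg i)]
  refine Finset.prod_congr rfl fun i _ => ?_
  rw [ofReal_integral_eq_lintegral_ofReal (hint i) (ae_of_all _ (hnonneg i)),
    withDensity_apply _ (hs i), ← lintegral_indicator (hs i)]
  congr 1 with x
  by_cases hx : x ∈ s i <;> simp [hx]

lemma stdGaussianPi_eq_withDensity (ι : Type*) [Fintype ι] :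
    stdGaussianPi ι = volume.withDensity fun z : ι → ℝ =>
      ENNReal.ofReal ((2 * Real.pi) ^ (-(Fintype.card ι : ℝ) / 2) *
        Real.exp (-(1 / 2) * (z ⬝ᵥ z))) := by
  have h : gaussianReal 0 1 = volume.withDensity fun x => ENNReal.ofReal (gaussianPDFReal 0 1 x) :=
    gaussianReal_of_var_ne_zero 0 one_ne_zero
  rw [stdGaussianPi, h, pi_withDensity_ofReal (integrable_gaussianPDFReal 0 1)
    (gaussianPDFReal_nonneg 0 1)]
  congr 1 with z
  congr 1
  have hpi : (0 : ℝ) ≤ 2 * Real.pi := by positivity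
  simp only [gaussianPDFReal, Finset.prod_mul_distrib, ← Real.exp_sum, Finset.prod_const,
    Finset.card_univ]
  congr 1
  · rw [NNReal.coe_one, mul_one, Real.sqrt_eq_rpow, ← Real.rpow_neg hpi, ← Real.rpow_natCast,
      ← Real.rpow_mul hpi]
    congr 1; ring
  · simp only [dotProduct, Finset.mul_sum]
    congr 1
    refine Finset.sum_congr rfl fun i _ => ?_
    simp; ring

lemma memLp_eval_stdGaussianPi {ι : Type*} [Fintype ι] (i : ι) :
    MemLp (fun z : ι → ℝ => z i) 2 (stdGaussianPi ι) :=
  (memLp_id_gaussianReal (μ := 0) (v := 1) 2).comp_measurePreserving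
    (measurePreserving_eval (fun _ : ι => gaussianReal 0 1) i)

lemma integral_eval_stdGaussianPi {ι : Type*} [Fintype ι] (i : ι) :
    ∫ z, z i ∂(stdGaussianPi ι) = 0 := by
  rw [stdGaussianPi, integral_eval, integral_id_gaussianReal]

lemma integral_eval_mul_eval_stdGaussianPi {ι : Type*} [Fintype ι] [DecidableEq ι] (i j : ι) :
    ∫ z, z i * z j ∂(stdGaussianPi ι) = (1 : Matrix ι ι ℝ) i j := by
  by_cases hij : i = j
  · subst hij
    have h := variance_id_gaussianReal (μ := 0) (v := 1)
    rw [variance_eq_integral aemeasurable_id] at h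
    simp only [id, integral_id_gaussianReal, sub_zero] at h
    rw [stdGaussianPi, integral_comp_eval (μ := fun _ : ι => gaussianReal 0 1) (i := i)
      (f := fun x : ℝ => x * x) (by fun_prop)]
    simpa [pow_two] using h
  · have hind := (iIndepFun_pi (μ := fun _ : ι => gaussianReal 0 1)
      (X := fun _ => (id : ℝ → ℝ)) fun _ => aemeasurable_id).indepFun hij
    have h := hind.integral_mul_eq_mul_integral
      (measurable_pi_apply i).aestronglyMeasurable (measurable_pi_apply j).aestronglyMeasurable
    rw [one_apply_ne hij]
    refine h.trans ?_
    rw [show ∫ z : ι → ℝ, id (z i) ∂(Measure.pi fun _ : ι => gaussianReal 0 1) = 0 from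
      integral_eval_stdGaussianPi i, zero_mul]

/-- Integrability and integral of a quadratic polynomial under the standard Gaussian measure. -/
lemma integral_quadratic_stdGaussianPi {ι : Type*} [Fintype ι] (c : ℝ) (v : ι → ℝ)
    (C : Matrix ι ι ℝ) :
    Integrable (fun z : ι → ℝ => c + v ⬝ᵥ z + z ⬝ᵥ C *ᵥ z) (stdGaussianPi ι) ∧
      ∫ z, (c + v ⬝ᵥ z + z ⬝ᵥ C *ᵥ z) ∂(stdGaussianPi ι) = c + C.trace := by
  have hquad (z : ι → ℝ) : z ⬝ᵥ C *ᵥ z = ∑ i, ∑ j, C i j * (z i * z j) := by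
    simp only [dotProduct, mulVec, Finset.mul_sum]
    exact Finset.sum_congr rfl fun i _ => Finset.sum_congr rfl fun j _ => by ring
  have h1 (i : ι) : Integrable (fun z : ι → ℝ => v i * z i) (stdGaussianPi ι) :=
    ((memLp_eval_stdGaussianPi i).integrable one_le_two).const_mul _
  have h2 (i j : ι) : Integrable (fun z : ι → ℝ => C i j * (z i * z j)) (stdGaussianPi ι) :=
    ((memLp_eval_stdGaussianPi i).integrable_mul (memLp_eval_stdGaussianPi j)).const_mul _
  have hlin : Integrable (fun z : ι → ℝ => v ⬝ᵥ z) (stdGaussianPi ι) :=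
    integrable_finsetSum _ fun i _ => h1 i
  have hsum (i : ι) : Integrable (fun z : ι → ℝ => ∑ j, C i j * (z i * z j)) (stdGaussianPi ι) :=
    integrable_finsetSum _ fun j _ => h2 i j
  have hadd : Integrable (fun z : ι → ℝ => c + v ⬝ᵥ z) (stdGaussianPi ι) :=
    (integrable_const c).add hlin
  simp_rw [hquad]
  refine ⟨hadd.add (integrable_finsetSum _ fun i _ => hsum i), ?_⟩
  rw [integral_add hadd (integrable_finsetSum _ fun i _ => hsum i),
    integral_add (integrable_const c) hlin, integral_finsetSum _ fun i _ => hsum i]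
  simp only [dotProduct]
  rw [integral_finsetSum _ fun i _ => h1 i]
  simp_rw [integral_finsetSum _ fun j _ => h2 _ j, integral_const_mul,
    integral_eval_stdGaussianPi, integral_eval_mul_eval_stdGaussianPi]
  simp [one_apply, trace]

/-- A positive definite real matrix has the form `L * Lᵀ` with `L` invertible. -/
lemma exists_mul_transpose_eq {M : ℕ} {B : Matrix (Fin M) (Fin M) ℝ} (hB : B.PosDef) :
    ∃ L : Matrix (Fin M) (Fin M) ℝ, L.det ≠ 0 ∧ L * Lᵀ = B := by
  open scoped MatrixOrder Matrix.Norms.L2Operator in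
  obtain ⟨y, hy, rfl⟩ := CStarAlgebra.isStrictlyPositive_iff_eq_star_mul_self.mp
    hB.isStrictlyPositive
  refine ⟨yᵀ, ?_, ?_⟩
  · rw [det_transpose]
    exact ((isUnit_iff_isUnit_det y).mp hy).ne_zero
  · simp [star_eq_conjTranspose, conjTranspose_eq_transpose_of_trivial]

/-- `N(a, L Lᵀ)` is the image of the standard Gaussian measure under `z ↦ a + L z`. -/
lemma mvGaussian_mul_transpose {M : ℕ} (a : Fin M → ℝ) {L : Matrix (Fin M) (Fin M) ℝ}
    (hL : L.det ≠ 0) :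
    mvGaussian a (L * Lᵀ) = (stdGaussianPi (Fin M)).map fun z => a + L *ᵥ z := by
  have hT : Measurable fun z : Fin M → ℝ => a + L *ᵥ z := by fun_prop
  have hvol : (volume : Measure (Fin M → ℝ)).map (fun z => a + L *ᵥ z) =
      ENNReal.ofReal |L.det⁻¹| • volume := by
    have h := Real.map_matrix_volume_pi_eq_smul_volume_pi hL
    have h' : (fun z : Fin M → ℝ => a + L *ᵥ z) = (a + ·) ∘ toLin' L := rfl
    rw [h', ← Measure.map_map (by fun_prop) (by fun_prop), h, Measure.map_smul,
      map_add_left_eq_self]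
  have hLu : IsUnit L.det := hL.isUnit
  have hquad (z : Fin M → ℝ) :
      (a + L *ᵥ z - a) ⬝ᵥ (L * Lᵀ)⁻¹ *ᵥ (a + L *ᵥ z - a) = z ⬝ᵥ z := by
    rw [add_sub_cancel_left, Matrix.mul_inv_rev, mulVec_mulVec, Matrix.mul_assoc,
      nonsing_inv_mul _ hLu, Matrix.mul_one, dotProduct_comm, dotProduct_mulVec,
      vecMul_mulVec, ← transpose_nonsing_inv, transpose_transpose, nonsing_inv_mul _ hLu, vecMul_one]
  have hdet : (L * Lᵀ).det ^ (-(1 : ℝ) / 2) = |L.det⁻¹| := by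
    rw [det_mul, det_transpose, ← pow_two, ← sq_abs, ← Real.rpow_natCast,
      ← Real.rpow_mul (abs_nonneg _), abs_inv, ← Real.rpow_neg_one]
    norm_num
  ext s hs
  rw [Measure.map_apply hT hs, stdGaussianPi_eq_withDensity, withDensity_apply _ (hT hs),
    mvGaussian, withDensity_apply _ hs]
  have hvol' : (volume : Measure (Fin M → ℝ)) =
      ENNReal.ofReal |L.det| • volume.map fun z => a + L *ᵥ z := by
    rw [hvol, smul_smul, ← ENNReal.ofReal_mul (abs_nonneg _), ← abs_mul, mul_inv_cancel₀ hL]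
    simp
  conv_lhs => rw [hvol']
  have hmeas : Measurable fun x : Fin M → ℝ =>
      ENNReal.ofReal ((2 * Real.pi) ^ (-(M : ℝ) / 2) * (L * Lᵀ).det ^ (-(1 : ℝ) / 2) *
        Real.exp (-(1 / 2) * ((x - a) ⬝ᵥ (L * Lᵀ)⁻¹ *ᵥ (x - a)))) := by
    fun_prop
  rw [Measure.restrict_smul, lintegral_smul_measure, setLIntegral_map hs hmeas hT, smul_eq_mul,
    ← lintegral_const_mul _ (by fun_prop)]
  refine lintegral_congr fun z => ?_
  rw [← ENNReal.ofReal_mul (abs_nonneg _), hquad, hdet, Fintype.card_fin]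
  congr 1
  rw [abs_inv]
  have : |L.det| ≠ 0 := abs_ne_zero.mpr hL
  field_simp

/-- Integrability and integral of a quadratic form under a multivariate Gaussian measure. -/
lemma integral_quadratic_mvGaussian {M : ℕ} (a b : Fin M → ℝ) {B : Matrix (Fin M) (Fin M) ℝ}
    (hB : B.PosDef) (A : Matrix (Fin M) (Fin M) ℝ) :
    Integrable (fun x => (x - b) ⬝ᵥ A *ᵥ (x - b)) (mvGaussian a B) ∧
      ∫ x, (x - b) ⬝ᵥ A *ᵥ (x - b) ∂(mvGaussian a B) =
        (B * A).trace + (a - b) ⬝ᵥ A *ᵥ (a - b) := by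
  obtain ⟨L, hL, rfl⟩ := exists_mul_transpose_eq hB
  have hT : Measurable fun z : Fin M → ℝ => a + L *ᵥ z := by fun_prop
  have hexpand (z : Fin M → ℝ) :
      (a + L *ᵥ z - b) ⬝ᵥ A *ᵥ (a + L *ᵥ z - b) =
        (a - b) ⬝ᵥ A *ᵥ (a - b) + ((A *ᵥ (a - b)) ᵥ* L + (a - b) ᵥ* (A * L)) ⬝ᵥ z +
          z ⬝ᵥ (Lᵀ * A * L) *ᵥ z := by
    have h1 : L *ᵥ z ⬝ᵥ A *ᵥ (a - b) = (A *ᵥ (a - b)) ᵥ* L ⬝ᵥ z := by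
      rw [dotProduct_comm, dotProduct_mulVec]
    have h2 : (a - b) ⬝ᵥ A *ᵥ (L *ᵥ z) = (a - b) ᵥ* (A * L) ⬝ᵥ z := by
      rw [mulVec_mulVec, dotProduct_mulVec]
    have h3 : L *ᵥ z ⬝ᵥ A *ᵥ (L *ᵥ z) = z ⬝ᵥ (Lᵀ * A * L) *ᵥ z := by
      rw [← mulVec_mulVec, ← mulVec_mulVec, dotProduct_mulVec z, vecMul_transpose]
    rw [add_sub_right_comm, mulVec_add, add_dotProduct, dotProduct_add, dotProduct_add, h1, h2, h3,
      add_dotProduct]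
    ring
  obtain ⟨hint, hval⟩ := integral_quadratic_stdGaussianPi ((a - b) ⬝ᵥ A *ᵥ (a - b))
    ((A *ᵥ (a - b)) ᵥ* L + (a - b) ᵥ* (A * L)) (Lᵀ * A * L)
  rw [mvGaussian_mul_transpose a hL]
  have hmeas : AEStronglyMeasurable (fun x => (x - b) ⬝ᵥ A *ᵥ (x - b))
      ((stdGaussianPi (Fin M)).map fun z => a + L *ᵥ z) := by
    fun_prop
  rw [integrable_map_measure hmeas hT.aemeasurable, integral_map hT.aemeasurable hmeas]
  refine ⟨by simpa only [Function.comp_def, hexpand] using hint, ?_⟩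
  simp_rw [hexpand]
  rw [hval, Matrix.mul_assoc, trace_mul_comm Lᵀ, Matrix.mul_assoc, trace_mul_comm, Matrix.mul_assoc,
    add_comm]

lemma isProbabilityMeasure_mvGaussian {M : ℕ} (a : Fin M → ℝ) {B : Matrix (Fin M) (Fin M) ℝ}
    (hB : B.PosDef) : IsProbabilityMeasure (mvGaussian a B) := by
  obtain ⟨L, hL, rfl⟩ := exists_mul_transpose_eq hB
  rw [mvGaussian_mul_transpose a hL]
  exact Measure.isProbabilityMeasure_map (by fun_prop)

/-- The logarithm of the density of `N(a, B)` with respect to `N(m, K)`. -/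
noncomputable def logRatio {M : ℕ} (a m : Fin M → ℝ) (B K : Matrix (Fin M) (Fin M) ℝ)
    (x : Fin M → ℝ) : ℝ :=
  -(1 / 2) * Real.log (B * K⁻¹).det - (1 / 2) * ((x - a) ⬝ᵥ B⁻¹ *ᵥ (x - a)) +
    (1 / 2) * ((x - m) ⬝ᵥ K⁻¹ *ᵥ (x - m))

lemma mvGaussian_eq_withDensity_logRatio {M : ℕ} (a m : Fin M → ℝ)
    {B K : Matrix (Fin M) (Fin M) ℝ} (hB : B.PosDef) (hK : K.PosDef) :
    mvGaussian a B =
      (mvGaussian m K).withDensity fun x => ENNReal.ofReal (Real.exp (logRatio a m B K x)) := by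
  have hB0 := hB.det_pos
  have hK0 := hK.det_pos
  rw [mvGaussian, mvGaussian, ← withDensity_mul _ (by fun_prop) (by unfold logRatio; fun_prop)]
  congr 1 with x
  rw [Pi.mul_apply, ← ENNReal.ofReal_mul (by positivity)]
  congr 1
  rw [logRatio, det_mul, det_nonsing_inv, Ring.inverse_eq_inv',
    Real.log_mul hB0.ne' (inv_ne_zero hK0.ne'), Real.log_inv, Real.rpow_def_of_pos hB0,
    Real.rpow_def_of_pos hK0, mul_assoc, mul_assoc, mul_assoc, ← Real.exp_add, ← Real.exp_add,
    ← Real.exp_add]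
  congr 2
  ring

lemma llr_mvGaussian {M : ℕ} (a m : Fin M → ℝ) {B K : Matrix (Fin M) (Fin M) ℝ}
    (hB : B.PosDef) (hK : K.PosDef) :
    llr (mvGaussian a B) (mvGaussian m K) =ᵐ[mvGaussian a B] logRatio a m B K := by
  have := isProbabilityMeasure_mvGaussian m hK
  have h := mvGaussian_eq_withDensity_logRatio a m hB hK
  have hac : mvGaussian a B ≪ mvGaussian m K := h ▸ withDensity_absolutelyContinuous _ _
  have hrn := Measure.rnDeriv_withDensity (mvGaussian m K)
    (f := fun x => ENNReal.ofReal (Real.exp (logRatio a m B K x))) (by unfold logRatio; fun_prop)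
  rw [← h] at hrn
  filter_upwards [hac.ae_le hrn] with x hx
  rw [llr, hx, ENNReal.toReal_ofReal (Real.exp_nonneg _), Real.log_exp]

end MvGaussian

open MvGaussian in
/-- **KL divergence between multivariate Gaussians with positive-definite covariances.**
`KL(N(a,B) ‖ N(m,K)) = −(1/2) ln det(BK⁻¹) + (1/2) tr(BK⁻¹) − M/2 + (1/2)(a−m)ᵀK⁻¹(a−m)`. -/
theorem klDiv_mvGaussian
    (M : ℕ) (hM : 0 < M) (a m : Fin M → ℝ) (B K : Matrix (Fin M) (Fin M) ℝ)
    (hB : B.PosDef) (hK : K.PosDef) :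
    klDiv (mvGaussian a B) (mvGaussian m K) =
      ENNReal.ofReal (-(1 / 2) * Real.log (B * K⁻¹).det + (1 / 2) * (B * K⁻¹).trace
        - (M : ℝ) / 2 + (1 / 2) * ((a - m) ⬝ᵥ K⁻¹ *ᵥ (a - m))) := by
  have := isProbabilityMeasure_mvGaussian a hB
  have hac : mvGaussian a B ≪ mvGaussian m K :=
    mvGaussian_eq_withDensity_logRatio a m hB hK ▸ withDensity_absolutelyContinuous _ _
  have hllr := llr_mvGaussian a m hB hK
  obtain ⟨hBint, hBval⟩ := integral_quadratic_mvGaussian a a hB B⁻¹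
  obtain ⟨hKint, hKval⟩ := integral_quadratic_mvGaussian a m hB K⁻¹
  have hconst := (integrable_const (μ := mvGaussian a B) (-(1 / 2) * Real.log (B * K⁻¹).det))
  have hsub : Integrable (fun x => -(1 / 2) * Real.log (B * K⁻¹).det -
      (1 / 2) * ((x - a) ⬝ᵥ B⁻¹ *ᵥ (x - a))) (mvGaussian a B) := hconst.sub (hBint.const_mul (1 / 2))
  have hint : Integrable (logRatio a m B K) (mvGaussian a B) := hsub.add (hKint.const_mul (1 / 2))
  rw [klDiv, if_pos ⟨hac, hint.congr hllr.symm⟩, integral_congr_ae hllr]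
  congr 1
  unfold logRatio
  rw [integral_add hsub (hKint.const_mul (1 / 2)), integral_sub hconst (hBint.const_mul (1 / 2)),
    integral_const, integral_const_mul, integral_const_mul, hBval, hKval,
    mul_nonsing_inv _ hB.det_pos.ne'.isUnit]
  simp
  ring
end

section
/- (PAC-Bayesian bound in additive (Pinsker) form.) Let H be a measurable hypothesis space, ℓ : Y×Y → [0,1] a measurable loss, μ a probability measure on X×Y, N a positive natural number, P a probability measure on H, and δ ∈ (0,1]. Then with probability at least 1−δ over the training set S drawn i.i.d. from μ^N, simultaneously for all probability measures Q on H: R(Q) ≤ R_S(Q) + √( (KL(Q‖P) + ln(2√N/δ)) / (2N) ). -/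
open MeasureTheory ENNReal NNReal
open scoped Classical

open ProbabilityTheory

/-- A linear minorant of the Gaussian `w ↦ exp (-2 w²)` on `[0, 1]`. -/
lemma one_sub_le_exp_neg_two_mul_sq {w : ℝ} (h0 : 0 ≤ w) (h1 : w ≤ 1) :
    1 - w ≤ Real.exp (-(2 * w ^ 2)) := by
  rcases le_total w (1 / 2) with h | h
  · have hexp : Real.exp (-(2 * w ^ 2)) = Real.exp (-w ^ 2) ^ 2 := by
      rw [← Real.exp_nat_mul]; congr 1; push_cast; ring
    have h2 : 1 - w ^ 2 ≤ Real.exp (-w ^ 2) := by linarith [Real.add_one_le_exp (-w ^ 2)]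
    have h3 : (1 - w ^ 2) ^ 2 ≤ Real.exp (-w ^ 2) ^ 2 :=
      pow_le_pow_left₀ (by nlinarith) h2 2
    have h4 : 0 ≤ w * (1 - w) * (1 - w - w ^ 2) :=
      mul_nonneg (mul_nonneg h0 (by linarith)) (by nlinarith)
    rw [hexp]
    nlinarith
  · have hexp : Real.exp (-(2 * w ^ 2)) = Real.exp (-1) * Real.exp (1 - 2 * w ^ 2) := by
      rw [← Real.exp_add]; congr 1; ring
    have h2 := Real.add_one_le_exp (1 - 2 * w ^ 2)
    have h3 : (1 / 3 : ℝ) ≤ Real.exp (-1) := by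
      rw [Real.exp_neg, one_div]
      exact inv_anti₀ (Real.exp_pos 1) (by linarith [Real.exp_one_lt_d9])
    have h4 : (1 / 3 : ℝ) * (2 - 2 * w ^ 2) ≤ Real.exp (-1) * Real.exp (1 - 2 * w ^ 2) :=
      mul_le_mul h3 (by linarith) (by nlinarith) (Real.exp_pos _).le
    rw [hexp]
    nlinarith [mul_nonneg (sub_nonneg.2 h1) (sub_nonneg.2 h)]

/-- A Gaussian centred in `[0, 1]` puts a definite amount of mass on `[0, 1]`. -/
lemma inv_two_sqrt_le_integral_exp_neg_sq {n x : ℝ} (hn : 1 ≤ n) (hx : x ∈ Set.Icc (0 : ℝ) 1) :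
    (2 * Real.sqrt n)⁻¹ ≤ ∫ t in (0 : ℝ)..1, Real.exp (-(2 * n * (t - x) ^ 2)) := by
  set r := Real.sqrt n
  have hr1 : 1 ≤ r := Real.one_le_sqrt.2 hn
  have hr0 : 0 < r := by linarith
  have hr2 : r ^ 2 = n := Real.sq_sqrt (by linarith)
  obtain ⟨hx0, hx1⟩ := hx
  set s := r⁻¹ with hs
  have hs0 : 0 < s := inv_pos.2 hr0
  have hs1 : s ≤ 1 := inv_le_one_of_one_le₀ hr1
  have hrs : r * s = 1 := mul_inv_cancel₀ hr0.ne'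
  set l := x * (1 - s)
  have hl0 : 0 ≤ l := mul_nonneg hx0 (by linarith)
  have hlx : l ≤ x := by nlinarith
  have hxl : x ≤ l + s := by nlinarith
  have hl1 : l + s ≤ 1 := by nlinarith
  have hcont : Continuous fun t : ℝ => Real.exp (-(2 * n * (t - x) ^ 2)) := by fun_prop
  have hint : ∀ a b : ℝ, IntervalIntegrable
      (fun t : ℝ => Real.exp (-(2 * n * (t - x) ^ 2))) volume a b :=
    fun a b => hcont.intervalIntegrable a b
  have hpt : ∀ t : ℝ, r * |t - x| ≤ 1 →
      1 - r * |t - x| ≤ Real.exp (-(2 * n * (t - x) ^ 2)) := fun t ht => by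
    have := one_sub_le_exp_neg_two_mul_sq (by positivity : 0 ≤ r * |t - x|) ht
    rwa [mul_pow, sq_abs, hr2, ← mul_assoc] at this
  have hleft : ∫ t in l..x, (1 - r * (x - t)) ≤
      ∫ t in l..x, Real.exp (-(2 * n * (t - x) ^ 2)) := by
    refine intervalIntegral.integral_mono_on hlx
      ((by fun_prop : Continuous fun t : ℝ => 1 - r * (x - t)).intervalIntegrable _ _)
      (hint _ _) fun t ht => ?_
    have habs : |t - x| = x - t := by rw [abs_sub_comm, abs_of_nonneg (by linarith [ht.2])]
    have := hpt t (by rw [habs]; nlinarith [ht.1])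
    rwa [habs] at this
  have hright : ∫ t in x..(l + s), (1 - r * (t - x)) ≤
      ∫ t in x..(l + s), Real.exp (-(2 * n * (t - x) ^ 2)) := by
    refine intervalIntegral.integral_mono_on hxl
      ((by fun_prop : Continuous fun t : ℝ => 1 - r * (t - x)).intervalIntegrable _ _)
      (hint _ _) fun t ht => ?_
    have habs : |t - x| = t - x := abs_of_nonneg (by linarith [ht.1])
    have := hpt t (by rw [habs]; nlinarith [ht.2])
    rwa [habs] at this
  have hleft_val : ∫ t in l..x, (1 - r * (x - t)) = (x - l) - r * (x - l) ^ 2 / 2 := by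
    rw [intervalIntegral.integral_comp_sub_left (fun t => 1 - r * t),
      intervalIntegral.integral_sub (by simp)
        ((by fun_prop : Continuous fun t : ℝ => r * t).intervalIntegrable _ _),
      intervalIntegral.integral_const_mul, integral_id]
    simp
    ring
  have hright_val : ∫ t in x..(l + s), (1 - r * (t - x)) =
      (l + s - x) - r * (l + s - x) ^ 2 / 2 := by
    rw [intervalIntegral.integral_comp_sub_right (fun t => 1 - r * t),
      intervalIntegral.integral_sub (by simp)
        ((by fun_prop : Continuous fun t : ℝ => r * t).intervalIntegrable _ _),
      intervalIntegral.integral_const_mul, integral_id]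
    simp
    ring
  have hsub : ∫ t in l..(l + s), Real.exp (-(2 * n * (t - x) ^ 2)) ≤
      ∫ t in (0 : ℝ)..1, Real.exp (-(2 * n * (t - x) ^ 2)) :=
    intervalIntegral.integral_mono_interval hl0 (by linarith) hl1
      (.of_forall fun _ => (Real.exp_pos _).le) (hint _ _)
  rw [← intervalIntegral.integral_add_adjacent_intervals (hint l x) (hint x (l + s))] at hsub
  have hquad : r * (x - l) ^ 2 + r * (l + s - x) ^ 2 ≤ s := by
    have h1 : 0 ≤ (x - l) * (l + s - x) := mul_nonneg (by linarith) (by linarith)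
    have h2 : r * (x - l) ^ 2 + r * (l + s - x) ^ 2 =
        (r * s) * s - 2 * (r * ((x - l) * (l + s - x))) := by ring
    rw [h2, hrs]
    nlinarith [mul_nonneg hr0.le h1]
  have : (2 * r)⁻¹ = s / 2 := by rw [hs, mul_inv]; ring
  rw [this]
  linarith

/-- The Donsker–Varadhan inequality for bounded functions. -/
lemma exp_integral_sub_integral_llr_le {α : Type*} [MeasurableSpace α] {P Q : Measure α}
    [IsProbabilityMeasure P] [IsProbabilityMeasure Q] (hQP : Q ≪ P)
    (hllr : Integrable (llr Q P) Q) {f : α → ℝ} (hf : Measurable f) {C : ℝ}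
    (hfC : ∀ a, |f a| ≤ C) :
    Real.exp (∫ a, f a ∂Q - ∫ a, llr Q P a ∂Q) ≤ ∫ a, Real.exp (f a) ∂P := by
  have hfQ : Integrable f Q := .of_bound hf.aestronglyMeasurable C (.of_forall hfC)
  have hfP : Integrable (fun a => Real.exp (f a)) P :=
    .of_bound (by fun_prop) (Real.exp C) (.of_forall fun a => by
      rw [Real.norm_eq_abs, Real.abs_exp]
      exact Real.exp_le_exp.2 ((le_abs_self _).trans (hfC a)))
  have := isProbabilityMeasure_tilted hfP
  have hac : Q ≪ P.tilted f := hQP.trans (absolutelyContinuous_tilted hfP)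
  have hint : Integrable (llr Q (P.tilted f)) Q := integrable_llr_tilted_right hQP hfQ hllr hfP
  have hnonneg := InformationTheory.integral_llr_add_sub_measure_univ_nonneg hac hint
  rw [integral_llr_tilted_right hQP hfQ hfP hllr] at hnonneg
  simp only [probReal_univ] at hnonneg
  rw [← Real.le_log_iff_exp_le (integral_exp_pos hfP)]
  linarith

/-- Hoeffding's bound on the moment generating function of the deviation of an empirical mean,
normalized so that the right-hand side is `1`. -/
lemma lintegral_exp_deviation_le_one {Z : Type*} [MeasurableSpace Z] (μ : Measure Z)
    [IsProbabilityMeasure μ] {N : ℕ} (hN : 0 < N) {g : Z → ℝ} (hg : Measurable g)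
    (hg01 : ∀ z, g z ∈ Set.Icc (0 : ℝ) 1) (t : ℝ) :
    ∫⁻ S, ENNReal.ofReal (Real.exp (4 * N * t *
        (∫ z, g z ∂μ - (N : ℝ)⁻¹ * ∑ i : Fin N, g (S i)) - 2 * N * t ^ 2))
      ∂(Measure.pi fun _ : Fin N => μ) ≤ 1 := by
  have hN' : (N : ℝ) ≠ 0 := by positivity
  set m := ∫ z, g z ∂μ
  have hsub := (hasSubgaussianMGF_of_mem_Icc hg.aemeasurable (.of_forall hg01 : ∀ᵐ z ∂μ, _)).neg
  have hint : Integrable (fun z => Real.exp (4 * t * (m - g z) - 2 * t ^ 2)) μ := by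
    simpa [Real.exp_sub] using (hsub.integrable_exp_mul (4 * t)).div_const (Real.exp (2 * t ^ 2))
  have hle : ∫ z, Real.exp (4 * t * (m - g z) - 2 * t ^ 2) ∂μ ≤ 1 := by
    have hmgf := hsub.mgf_le (4 * t)
    simp only [Real.exp_sub, integral_div]
    rw [div_le_one (Real.exp_pos _)]
    calc ∫ z, Real.exp (4 * t * (m - g z)) ∂μ
        = mgf (-fun z => g z - m) μ (4 * t) := by simp [mgf, m]
      _ ≤ _ := hmgf
      _ = Real.exp (2 * t ^ 2) := by
        congr 1
        simp
        ring
  have hprod : ∀ S : Fin N → Z, Real.exp (4 * N * t *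
      (m - (N : ℝ)⁻¹ * ∑ i : Fin N, g (S i)) - 2 * N * t ^ 2) =
      ∏ i : Fin N, Real.exp (4 * t * (m - g (S i)) - 2 * t ^ 2) := fun S => by
    rw [← Real.exp_sum]
    congr 1
    simp only [Finset.sum_sub_distrib, ← Finset.mul_sum, Finset.sum_const, Finset.card_univ,
      Fintype.card_fin, nsmul_eq_mul]
    field_simp
  simp only [hprod]
  rw [← ofReal_integral_eq_lintegral_ofReal (Integrable.fintype_prod fun _ => hint)
    (.of_forall fun S => Finset.prod_nonneg fun i _ => (Real.exp_pos _).le),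
    integral_fintype_prod_eq_prod (fun _ z => Real.exp (4 * t * (m - g z) - 2 * t ^ 2)),
    ENNReal.ofReal_le_one]
  exact Finset.prod_le_one (fun _ _ => integral_nonneg fun _ => (Real.exp_pos _).le)
    fun _ _ => hle

/-- If the Gaussian mixture of exponential moments of `X` under `P` is small, then the mean of `X`
under every `Q` is controlled by the relative entropy of `Q` with respect to `P`. -/
lemma two_mul_integral_sq_le_of_lintegral_lt {H : Type*} [MeasurableSpace H] {P Q : Measure H}
    [IsProbabilityMeasure P] [IsProbabilityMeasure Q] (hQP : Q ≪ P)
    (hllr : Integrable (llr Q P) Q) {n : ℝ} (hn : 1 ≤ n) {X : H → ℝ} (hX : Measurable X)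
    (hX1 : ∀ h, |X h| ≤ 1) {δ : ℝ} (hδ : 0 < δ)
    (hΦ : ∫⁻ t in Set.Icc (0 : ℝ) 1, ∫⁻ h,
      ENNReal.ofReal (Real.exp (4 * n * t * X h - 2 * n * t ^ 2)) ∂P < ENNReal.ofReal δ⁻¹)
    (hx : 0 ≤ ∫ h, X h ∂Q) :
    2 * n * (∫ h, X h ∂Q) ^ 2 ≤ ∫ h, llr Q P h ∂Q + Real.log (2 * Real.sqrt n / δ) := by
  set x := ∫ h, X h ∂Q
  set K := ∫ h, llr Q P h ∂Q
  have hx1 : x ≤ 1 := by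
    have := norm_integral_le_of_norm_le_const (μ := Q) (f := X) (C := 1) (.of_forall hX1)
    simp only [probReal_univ, mul_one] at this
    exact (le_abs_self _).trans this
  have hcont : Continuous fun t : ℝ => Real.exp (4 * n * t * x - 2 * n * t ^ 2 - K) := by fun_prop
  have hslice : ∀ t : ℝ, t ∈ Set.Icc (0 : ℝ) 1 →
      ENNReal.ofReal (Real.exp (4 * n * t * x - 2 * n * t ^ 2 - K)) ≤
        ∫⁻ h, ENNReal.ofReal (Real.exp (4 * n * t * X h - 2 * n * t ^ 2)) ∂P := fun t ht => by
    have hnt : 0 ≤ 4 * n * t := by nlinarith [ht.1]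
    have hbdd : ∀ h, |4 * n * t * X h - 2 * n * t ^ 2| ≤ 4 * n * t + 2 * n * t ^ 2 := fun h => by
      refine (abs_sub _ _).trans (add_le_add ?_ ?_)
      · rw [abs_mul, abs_of_nonneg hnt]
        exact mul_le_of_le_one_right hnt (hX1 h)
      · rw [abs_of_nonneg (by positivity)]
    have hdv := exp_integral_sub_integral_llr_le hQP hllr
      (f := fun h => 4 * n * t * X h - 2 * n * t ^ 2) (by fun_prop) hbdd
    have hXQ : Integrable X Q := .of_bound hX.aestronglyMeasurable 1 (.of_forall hX1)
    rw [integral_sub (hXQ.const_mul _) (integrable_const _), integral_const_mul] at hdv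
    simp only [integral_const, probReal_univ, one_smul] at hdv
    rw [← ofReal_integral_eq_lintegral_ofReal _ (.of_forall fun _ => (Real.exp_pos _).le)]
    · exact ENNReal.ofReal_le_ofReal hdv
    · refine .of_bound (by fun_prop) (Real.exp (4 * n * t + 2 * n * t ^ 2)) (.of_forall fun h => ?_)
      rw [Real.norm_eq_abs, Real.abs_exp]
      exact Real.exp_le_exp.2 ((le_abs_self _).trans (hbdd h))
  have hmix : ∫ t in (0 : ℝ)..1, Real.exp (4 * n * t * x - 2 * n * t ^ 2 - K) < δ⁻¹ := by
    refine (ENNReal.ofReal_lt_ofReal_iff (inv_pos.2 hδ)).1 (lt_of_le_of_lt ?_ hΦ)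
    rw [intervalIntegral.integral_of_le zero_le_one, ← integral_Icc_eq_integral_Ioc,
      ofReal_integral_eq_lintegral_ofReal hcont.integrableOn_Icc
        (.of_forall fun _ => (Real.exp_pos _).le)]
    exact setLIntegral_mono' measurableSet_Icc hslice
  have hsquare : ∀ t : ℝ, Real.exp (4 * n * t * x - 2 * n * t ^ 2 - K) =
      Real.exp (2 * n * x ^ 2 - K) * Real.exp (-(2 * n * (t - x) ^ 2)) := fun t => by
    rw [← Real.exp_add]; congr 1; ring
  simp only [hsquare, intervalIntegral.integral_const_mul] at hmix
  have hmass := inv_two_sqrt_le_integral_exp_neg_sq hn ⟨hx, hx1⟩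
  have hr : 0 < 2 * Real.sqrt n := by
    have := Real.sqrt_pos.2 (by linarith : 0 < n)
    linarith
  have hexp : Real.exp (2 * n * x ^ 2 - K) ≤ 2 * Real.sqrt n / δ := by
    have := (mul_le_mul_of_nonneg_left hmass (Real.exp_pos (2 * n * x ^ 2 - K)).le).trans hmix.le
    rwa [← div_eq_mul_inv, div_le_iff₀ hr, inv_mul_eq_div] at this
  have := (Real.le_log_iff_exp_le (by positivity)).2 hexp
  linarith

/-- With probability at least `1 - δ`, the Gaussian mixture of exponential moments of the deviation
between risk and empirical risk is smaller than `δ⁻¹`. -/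
lemma one_sub_le_measure_lintegral_exp_deviation_lt {H Z : Type*} [MeasurableSpace H]
    [MeasurableSpace Z] (μ : Measure Z) [IsProbabilityMeasure μ] (P : Measure H)
    [IsProbabilityMeasure P] {N : ℕ} (hN : 0 < N) {L : H → Z → ℝ}
    (hL : Measurable fun p : H × Z => L p.1 p.2) (hL01 : ∀ h z, L h z ∈ Set.Icc (0 : ℝ) 1)
    {δ : ℝ} (hδ : 0 < δ) :
    ENNReal.ofReal (1 - δ) ≤ (Measure.pi fun _ : Fin N => μ)
      {S | ∫⁻ t in Set.Icc (0 : ℝ) 1, ∫⁻ h, ENNReal.ofReal (Real.exp (4 * N * t *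
        (∫ z, L h z ∂μ - (N : ℝ)⁻¹ * ∑ i : Fin N, L h (S i)) - 2 * N * t ^ 2)) ∂P
          < ENNReal.ofReal δ⁻¹} := by
  set F : (Fin N → Z) → ℝ × H → ℝ≥0∞ := fun S p => ENNReal.ofReal (Real.exp (4 * N * p.1 *
    (∫ z, L p.2 z ∂μ - (N : ℝ)⁻¹ * ∑ i : Fin N, L p.2 (S i)) - 2 * N * p.1 ^ 2)) with hF
  have hR : Measurable fun h => ∫ z, L h z ∂μ :=
    hL.stronglyMeasurable.integral_prod_right.measurable
  have hRS : Measurable fun q : (Fin N → Z) × (ℝ × H) => ∑ i : Fin N, L q.2.2 (q.1 i) :=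
    Finset.measurable_sum _ fun i _ => hL.comp (by fun_prop : Measurable
      fun q : (Fin N → Z) × (ℝ × H) => (q.2.2, q.1 i))
  have hR' : Measurable fun q : (Fin N → Z) × (ℝ × H) => ∫ z, L q.2.2 z ∂μ :=
    hR.comp (by fun_prop)
  have hFmeas : Measurable (Function.uncurry F) := by
    simp only [hF, Function.uncurry_def]
    fun_prop
  set ν := (volume.restrict (Set.Icc (0 : ℝ) 1)).prod P with hν
  have : IsProbabilityMeasure (volume.restrict (Set.Icc (0 : ℝ) 1)) := ⟨by simp⟩
  set Φ : (Fin N → Z) → ℝ≥0∞ := fun S => ∫⁻ p, F S p ∂ν with hΦ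
  have hΦmeas : Measurable Φ := hFmeas.lintegral_prod_right'
  have hΦint : ∫⁻ S, Φ S ∂(Measure.pi fun _ : Fin N => μ) ≤ 1 := by
    rw [lintegral_lintegral_swap hFmeas.aemeasurable]
    calc ∫⁻ p, ∫⁻ S, F S p ∂(Measure.pi fun _ : Fin N => μ) ∂ν ≤ ∫⁻ _, 1 ∂ν :=
          lintegral_mono fun p => lintegral_exp_deviation_le_one μ hN
            (hL.comp measurable_prodMk_left) (hL01 p.2) p.1
      _ = 1 := by simp
  have hset : {S | ∫⁻ t in Set.Icc (0 : ℝ) 1, ∫⁻ h, F S (t, h) ∂P < ENNReal.ofReal δ⁻¹} =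
      {S | ENNReal.ofReal δ⁻¹ ≤ Φ S}ᶜ := by
    ext S
    simp only [Set.mem_ofPred_eq, Set.mem_compl_iff, not_le, hΦ, hν]
    rw [lintegral_prod (F S) (hFmeas.comp measurable_prodMk_left).aemeasurable]
  change _ ≤ (Measure.pi fun _ : Fin N => μ)
    {S | ∫⁻ t in Set.Icc (0 : ℝ) 1, ∫⁻ h, F S (t, h) ∂P < ENNReal.ofReal δ⁻¹}
  have hmarkov : (Measure.pi fun _ : Fin N => μ) {S | ENNReal.ofReal δ⁻¹ ≤ Φ S} ≤
      ENNReal.ofReal δ := by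
    have hδ' : 0 < δ⁻¹ := inv_pos.2 hδ
    refine (meas_ge_le_lintegral_div hΦmeas.aemeasurable (ENNReal.ofReal_pos.2 hδ').ne'
      ENNReal.ofReal_ne_top).trans ((ENNReal.div_le_div_right hΦint _).trans ?_)
    rw [one_div, ENNReal.ofReal_inv_of_pos hδ, inv_inv]
  rw [hset, prob_compl_eq_one_sub (measurableSet_le measurable_const hΦmeas),
    ENNReal.ofReal_sub _ hδ.le, ENNReal.ofReal_one]
  exact tsub_le_tsub_left hmarkov 1

/-- **PAC-Bayesian bound in additive (Pinsker) form.** With probability at least `1 − δ` over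
`S ∼ μ^N`, simultaneously for all probability measures `Q`:
`R(Q) ≤ R_S(Q) + √((KL(Q‖P) + ln(2√N/δ)) / (2N))`. -/
theorem pac_bayes_pinsker_form
    {H X Y : Type*} [MeasurableSpace H] [MeasurableSpace X] [MeasurableSpace Y]
    (ev : H → X → Y) (hev : Measurable fun p : H × X => ev p.1 p.2)
    (ℓ : Y → Y → ℝ) (hℓ : Measurable fun p : Y × Y => ℓ p.1 p.2)
    (hℓ01 : ∀ y y', ℓ y y' ∈ Set.Icc (0 : ℝ) 1)
    (μ : Measure (X × Y)) [IsProbabilityMeasure μ]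
    (N : ℕ) (hN : 0 < N)
    (P : Measure H) [IsProbabilityMeasure P]
    (δ : ℝ) (hδ : 0 < δ) (hδ1 : δ ≤ 1) :
    ENNReal.ofReal (1 - δ) ≤
      (Measure.pi fun _ : Fin N => μ)
        {S | ∀ Q : Measure H, IsProbabilityMeasure Q →
          ENNReal.ofReal (∫ h, ∫ z, ℓ z.2 (ev h z.1) ∂μ ∂Q) ≤
            ENNReal.ofReal (∫ h, (N : ℝ)⁻¹ * ∑ i : Fin N, ℓ (S i).2 (ev h (S i).1) ∂Q)
              + ((klDiv Q P + ENNReal.ofReal (Real.log (2 * Real.sqrt N / δ)))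
                  / (2 * (N : ℝ≥0∞))) ^ ((1 : ℝ) / 2)} := by
  set L : H → X × Y → ℝ := fun h z => ℓ z.2 (ev h z.1)
  have hL : Measurable fun p : H × (X × Y) => L p.1 p.2 :=
    hℓ.comp (measurable_snd.snd.prodMk
      (hev.comp (measurable_fst.prodMk measurable_snd.fst)))
  have hL01 : ∀ h z, L h z ∈ Set.Icc (0 : ℝ) 1 := fun h z => hℓ01 _ _
  have hN1 : (1 : ℝ) ≤ N := by exact_mod_cast hN
  have hN0 : (0 : ℝ) < N := by linarith
  refine (one_sub_le_measure_lintegral_exp_deviation_lt μ P hN hL hL01 hδ).trans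
    (measure_mono fun S hS Q hQ => ?_)
  change ENNReal.ofReal (∫ h, ∫ z, L h z ∂μ ∂Q) ≤
    ENNReal.ofReal (∫ h, (N : ℝ)⁻¹ * ∑ i : Fin N, L h (S i) ∂Q) + _
  unfold klDiv
  split_ifs with hKL
  swap
  · rw [top_add, ENNReal.top_div_of_ne_top (by finiteness),
      ENNReal.top_rpow_of_pos (by norm_num), add_top]
    exact le_top
  obtain ⟨hQP, hllr⟩ := hKL
  have hR : Measurable fun h => ∫ z, L h z ∂μ :=
    hL.stronglyMeasurable.integral_prod_right.measurable
  have hRS : Measurable fun h => (N : ℝ)⁻¹ * ∑ i : Fin N, L h (S i) :=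
    (Finset.measurable_sum _ fun i _ => hL.comp measurable_prodMk_right).const_mul _
  have hR01 : ∀ h, ∫ z, L h z ∂μ ∈ Set.Icc (0 : ℝ) 1 := fun h => by
    refine ⟨integral_nonneg fun z => (hL01 h z).1, ?_⟩
    simpa using integral_mono (μ := μ) (.of_mem_Icc 0 1
      (hL.comp measurable_prodMk_left).aemeasurable (.of_forall (hL01 h)))
      (integrable_const (1 : ℝ)) fun z => (hL01 h z).2
  have hRS01 : ∀ h, (N : ℝ)⁻¹ * ∑ i : Fin N, L h (S i) ∈ Set.Icc (0 : ℝ) 1 := fun h => by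
    refine ⟨mul_nonneg (by positivity) (Finset.sum_nonneg fun i _ => (hL01 h _).1), ?_⟩
    rw [inv_mul_le_iff₀ hN0, mul_one]
    simpa using Finset.sum_le_card_nsmul Finset.univ (fun i => L h (S i)) 1
      fun i _ => (hL01 h _).2
  have hdiff : ∫ h, (∫ z, L h z ∂μ - (N : ℝ)⁻¹ * ∑ i : Fin N, L h (S i)) ∂Q =
      ∫ h, ∫ z, L h z ∂μ ∂Q - ∫ h, (N : ℝ)⁻¹ * ∑ i : Fin N, L h (S i) ∂Q :=
    integral_sub (.of_mem_Icc 0 1 hR.aemeasurable (.of_forall hR01))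
      (.of_mem_Icc 0 1 hRS.aemeasurable (.of_forall hRS01))
  have hmain := two_mul_integral_sq_le_of_lintegral_lt hQP hllr hN1 (hR.sub hRS)
    (fun h => abs_sub_le_iff.2
      ⟨by linarith [(hR01 h).2, (hRS01 h).1], by linarith [(hR01 h).1, (hRS01 h).2]⟩) hδ hS
  simp only [Pi.sub_apply, hdiff] at hmain
  set r := ∫ h, ∫ z, L h z ∂μ ∂Q
  set s := ∫ h, (N : ℝ)⁻¹ * ∑ i : Fin N, L h (S i) ∂Q
  set M := ∫ h, llr Q P h ∂Q + Real.log (2 * Real.sqrt N / δ)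
  rcases le_total r s with hrs | hrs
  · exact (ENNReal.ofReal_le_ofReal hrs).trans le_self_add
  have hM2 : 2 * N * (r - s) ^ 2 ≤ M := hmain (sub_nonneg.2 hrs)
  have hgap : ENNReal.ofReal (r - s) ≤
      (ENNReal.ofReal M / (2 * (N : ℝ≥0∞))) ^ ((1 : ℝ) / 2) := by
    have hcast : 2 * (N : ℝ≥0∞) = ENNReal.ofReal (2 * N) := by
      rw [ENNReal.ofReal_mul zero_le_two, ENNReal.ofReal_natCast, ENNReal.ofReal_ofNat]
    have hM0 : 0 ≤ M / (2 * N) := div_nonneg (le_trans (by positivity) hM2) (by positivity)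
    rw [hcast, ← ENNReal.ofReal_div_of_pos (by positivity),
      ENNReal.ofReal_rpow_of_nonneg hM0 (by norm_num), ← Real.sqrt_eq_rpow]
    refine ENNReal.ofReal_le_ofReal (Real.le_sqrt_of_sq_le ?_)
    rwa [le_div_iff₀ (by positivity), mul_comm]
  calc ENNReal.ofReal r = ENNReal.ofReal (s + (r - s)) := by rw [add_sub_cancel]
    _ ≤ ENNReal.ofReal s + ENNReal.ofReal (r - s) := ENNReal.ofReal_add_le
    _ ≤ _ := by
      gcongr
      refine hgap.trans ?_
      gcongr
      exact ENNReal.ofReal_add_le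
end
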